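/- arXiv:2210.09438 — 4 statements merged into one kernel-verified Lean document; each statement's English description precedes it below -/
import Mathlib

section
/- Let V be a finite-dimensional real vector space, W a real vector space with a symmetric bilinear form, and φ : V × V → W a flat bilinear form, i.e., ⟨φ(X,Y), φ(Z,T)⟩ − ⟨φ(X,T), φ(Z,Y)⟩ = 0 for all X,Y,Z,T ∈ V. If X ∈ V is a regular element of φ (meaning dim φ_X(V) is maximal among all elements of V, where φ_X(Y) = φ(X,Y)), then the span of {φ(Y,Z) : Y ∈ V, Z ∈ ker φ_X} is contained in φ_X(V) ∩ (φ_X(V))^⊥. -/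
/-- If no map in the pencil `g - μ • f` has larger rank than `f`, then `g` maps the kernel of `f`
into the range of `f`. -/
theorem LinearMap.apply_mem_range_of_finrank_range_sub_smul_le {K V W : Type*} [Field K]
    [Infinite K] [AddCommGroup V] [Module K V] [FiniteDimensional K V] [AddCommGroup W] [Module K W]
    (f g : V →ₗ[K] W)
    (h : ∀ μ : K, Module.finrank K (LinearMap.range (g - μ • f)) ≤
      Module.finrank K (LinearMap.range f))
    {z : V} (hz : f z = 0) : g z ∈ LinearMap.range f := by
  by_contra hw
  obtain ⟨s, hs⟩ := f.rangeRestrict.exists_rightInverse_of_surjective f.range_rangeRestrict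
  have hfs (a : LinearMap.range f) : f (s a) = a :=
    congrArg Subtype.val (LinearMap.congr_fun hs a)
  let u : (LinearMap.range f × K) →ₗ[K] W :=
    (LinearMap.range f).subtype.coprod (LinearMap.toSpanSingleton K W (g z))
  have hu : LinearMap.ker u = ⊥ := by
    rw [LinearMap.ker_eq_bot']
    rintro ⟨a, k⟩ hak
    replace hak : (a : W) + k • g z = 0 := by simpa [u] using hak
    have hk : k = 0 := by
      by_contra hk
      apply hw
      rw [← (LinearMap.range f).smul_mem_iff hk, eq_neg_of_add_eq_zero_right hak]
      exact neg_mem a.2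
    subst hk
    simpa using hak
  obtain ⟨p, hp⟩ := u.exists_leftInverse_of_injective hu
  have hpu (x) : p (u x) = x := LinearMap.congr_fun hp x
  let M : Module.End K (LinearMap.range f × K) := p ∘ₗ g ∘ₗ s ∘ₗ LinearMap.fst K _ _
  obtain ⟨μ, hμ⟩ := (Module.End.finite_hasEigenvalue M).exists_notMem
  let q : (LinearMap.range f × K) →ₗ[K] V :=
    s.coprod (LinearMap.toSpanSingleton K V (-μ • z))
  have hq (x) : p ((g - μ • f) (q x)) = (M - algebraMap K _ μ) x := by
    have : (g - μ • f) (q x) = g (s x.1) - μ • u x := by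
      simp [q, u, hfs, hz, smul_smul, mul_comm]
      abel
    rw [this, map_sub, map_smul, hpu]
    rfl
  have hinj : Function.Injective ((g - μ • f).rangeRestrict ∘ₗ q) := by
    rw [← LinearMap.ker_eq_bot, LinearMap.ker_eq_bot']
    intro x hx
    have hx' : (g - μ • f) (q x) = 0 := congrArg Subtype.val hx
    have hMx : (M - algebraMap K _ μ) x = 0 := by rw [← hq, hx', map_zero]
    by_contra hx0
    refine hμ (Module.End.hasEigenvalue_of_hasEigenvector (x := x) ⟨?_, hx0⟩)
    rw [Module.End.mem_eigenspace_iff]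
    exact sub_eq_zero.mp hMx
  have hle := (LinearMap.finrank_le_finrank_of_injective hinj).trans (h μ)
  rw [Module.finrank_prod, Module.finrank_self] at hle
  omega

/-- For a flat bilinear form φ and a regular element X,
S(φ|_{V × ker φ_X}) ⊆ φ_X(V) ∩ (φ_X(V))^⊥. -/
theorem stmt_1 (V W : Type*) [AddCommGroup V] [Module ℝ V] [FiniteDimensional ℝ V]
    [AddCommGroup W] [Module ℝ W]
    (B : LinearMap.BilinForm ℝ W) (hsymm : B.IsSymm)
    (φ : V →ₗ[ℝ] V →ₗ[ℝ] W)
    (hflat : ∀ X Y Z T : V, B (φ X Y) (φ Z T) = B (φ X T) (φ Z Y))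
    (X : V)
    (hreg : ∀ Z : V, Module.finrank ℝ (LinearMap.range (φ Z)) ≤
      Module.finrank ℝ (LinearMap.range (φ X))) :
    Submodule.span ℝ {w : W | ∃ Y Z : V, Z ∈ LinearMap.ker (φ X) ∧ w = φ Y Z} ≤
      LinearMap.range (φ X) ⊓ B.orthogonal (LinearMap.range (φ X)) := by
  rw [Submodule.span_le]
  rintro _ ⟨Y, Z, hZ, rfl⟩
  rw [LinearMap.mem_ker] at hZ
  refine ⟨LinearMap.apply_mem_range_of_finrank_range_sub_smul_le (φ X) (φ Y) (fun μ => ?_) hZ, ?_⟩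
  · rw [← map_smul, ← map_sub]
    exact hreg _
  · rintro _ ⟨T, rfl⟩
    change B (φ X T) (φ Y Z) = 0
    rw [hflat, hZ, map_zero, LinearMap.zero_apply]
end

section
/- Let β : V^{2n} × V^{2n} → W^{p,p} = L^p ⊕ L^p with p ≤ n be the flat bilinear form arising from a symmetric bilinear form α via β(X,Y) = (α(X,Y)+α(JX,JY), α(X,JY)−α(JX,Y)). If β is surjective (its image spans W^{p,p}), then dim N(β) ≥ 2n − 2p, where N(β) is the kernel of β. Moreover, if N(β) = 0 and X is a regular element of β, then β_X : V^{2n} → W^{p,p} is a linear isomorphism. -/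
open Filter Topology Module

section Lorentzian

variable {L : Type*} [AddCommGroup L] [Module ℝ L]

/-- A symmetric bilinear form that is negative on some line and positive definite on the
orthogonal complement of that line. -/
def IsLorentzian (B : LinearMap.BilinForm ℝ L) : Prop :=
  (∀ x y, B x y = B y x) ∧ ∃ w : L, B w w = -1 ∧ ∀ x : L, B x w = 0 → x ≠ 0 → 0 < B x x

namespace IsLorentzian

variable {B : LinearMap.BilinForm ℝ L}

theorem eq_smul_or_pos_of_orthogonal_null (hB : IsLorentzian B) {e x : L} (he : e ≠ 0)
    (hee : B e e = 0) (hex : B e x = 0) : (∃ k : ℝ, x = k • e) ∨ 0 < B x x := by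
  obtain ⟨hs, w, -, hw⟩ := hB
  have hew : B e w ≠ 0 := fun h ↦ (hw e h he).ne' hee
  by_cases hy : x - (B x w / B e w) • e = 0
  · exact Or.inl ⟨_, sub_eq_zero.mp hy⟩
  · right
    have hpos := hw _ (by simp [hew]) hy
    simpa [hee, hex, hs x e] using hpos

theorem nonneg_of_orthogonal_null (hB : IsLorentzian B) {e x : L} (he : e ≠ 0)
    (hee : B e e = 0) (hex : B e x = 0) : 0 ≤ B x x := by
  rcases hB.eq_smul_or_pos_of_orthogonal_null he hee hex with ⟨k, rfl⟩ | h
  · simp [hee]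
  · exact h.le

theorem exists_eq_smul_of_orthogonal_null (hB : IsLorentzian B) {e x : L} (he : e ≠ 0)
    (hee : B e e = 0) (hex : B e x = 0) (hxx : B x x = 0) : ∃ k : ℝ, x = k • e :=
  (hB.eq_smul_or_pos_of_orthogonal_null he hee hex).resolve_right hxx.not_gt

/-- Three null vectors of a Lorentzian space cannot have pairwise opposite time orientations. -/
theorem not_three_null_pos (hB : IsLorentzian B) {e₁ e₂ e₃ : L} (h₁ : B e₁ e₁ = 0)
    (h₂ : B e₂ e₂ = 0) (h₃ : B e₃ e₃ = 0) (h₁₂ : 0 < B e₁ e₂) (h₁₃ : 0 < B e₁ e₃)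
    (h₂₃ : 0 < B e₂ e₃) : False := by
  obtain ⟨hs, w, -, hw⟩ := hB
  have ne_zero {e : L} (hee : B e e = 0) {f : L} (hef : 0 < B e f) : B e w ≠ 0 := by
    refine fun h ↦ (hw e h ?_).ne' hee
    rintro rfl
    simp at hef
  have key {e f : L} (hee : B e e = 0) (hff : B f f = 0) (hef : 0 < B e f) :
      B e w * B f w < 0 := by
    have hfe : 0 < B f e := hs e f ▸ hef
    have hne := mul_ne_zero (ne_zero hee hef) (ne_zero hff hfe)
    refine lt_of_le_of_ne ?_ hne
    have hnonneg : 0 ≤ B (B f w • e - B e w • f) (B f w • e - B e w • f) := by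
      by_cases hy : B f w • e - B e w • f = 0
      · simp [hy]
      · exact (hw _ (by simp [mul_comm]) hy).le
    simp only [map_sub, map_smul, LinearMap.sub_apply, LinearMap.smul_apply, smul_eq_mul, hee,
      hff, hs f e] at hnonneg
    by_contra! hlt
    nlinarith [mul_pos hlt hef]
  have k₁₂ := key h₁ h₂ h₁₂
  have k₁₃ := key h₁ h₃ h₁₃
  have k₂₃ := key h₂ h₃ h₂₃
  nlinarith [mul_pos_of_neg_of_neg k₁₂ k₁₃, sq_nonneg (B e₁ w),
    mul_nonneg (sq_nonneg (B e₁ w)) (neg_nonneg.mpr k₂₃.le)]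

end IsLorentzian

end Lorentzian

section Rank

variable {V W : Type*} [AddCommGroup V] [Module ℝ V] [FiniteDimensional ℝ V]
  [AddCommGroup W] [Module ℝ W]

theorem LinearMap.eventually_injective_id_add_smul (M : V →ₗ[ℝ] V) :
    ∀ᶠ t in 𝓝 (0 : ℝ), Function.Injective (LinearMap.id + t • M : V →ₗ[ℝ] V) := by
  let v := finBasis ℝ V
  have hcont : Continuous fun t : ℝ ↦ (1 + t • LinearMap.toMatrix v v M).det := by fun_prop
  filter_upwards [hcont.continuousAt.eventually_ne
    (by simp : (1 + (0 : ℝ) • LinearMap.toMatrix v v M).det ≠ 0)] with t ht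
  have hdet : LinearMap.det (LinearMap.id + t • M : V →ₗ[ℝ] V) ≠ 0 := by
    rw [← LinearMap.det_toMatrix v]
    simpa using ht
  exact ((LinearMap.isUnit_iff_isUnit_det _).mpr hdet.isUnit |> (Module.End.isUnit_iff _).mp).1

theorem LinearMap.eventually_finrank_range_le (f g : V →ₗ[ℝ] W) :
    ∀ᶠ t in 𝓝 (0 : ℝ), finrank ℝ (LinearMap.range f) ≤ finrank ℝ (LinearMap.range (f + t • g)) := by
  obtain ⟨C, hC⟩ := Submodule.exists_isCompl (LinearMap.ker f)
  have hinj : LinearMap.ker (f ∘ₗ C.subtype) = ⊥ := by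
    rw [LinearMap.ker_eq_bot']
    intro c hc
    have : (c : V) ∈ LinearMap.ker f ⊓ C := ⟨hc, c.2⟩
    rw [hC.inf_eq_bot] at this
    exact Subtype.ext this
  obtain ⟨P, hP⟩ := LinearMap.exists_leftInverse_of_injective _ hinj
  have hfin : finrank ℝ (LinearMap.range f) = finrank ℝ C := by
    have h₁ := Submodule.finrank_add_eq_of_isCompl hC
    have h₂ := f.finrank_range_add_finrank_ker
    lia
  filter_upwards [(P ∘ₗ g ∘ₗ C.subtype).eventually_injective_id_add_smul] with t ht
  have hcomp : LinearMap.id + t • (P ∘ₗ g ∘ₗ C.subtype) = P ∘ₗ (f + t • g) ∘ₗ C.subtype := by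
    rw [← hP]
    ext c
    simp
  rw [hcomp] at ht
  have hinj' : Function.Injective ((f + t • g) ∘ₗ C.subtype) :=
    Function.Injective.of_comp (f := P) (by simpa using ht)
  rw [hfin, ← LinearMap.finrank_range_of_inj hinj']
  exact Submodule.finrank_mono (LinearMap.range_comp_le_range _ _)

/-- If `f` has maximal rank on the line `f + t • g`, then `g` maps the kernel of `f` into the
range of `f`. -/
theorem LinearMap.mem_range_of_finrank_range_le [FiniteDimensional ℝ W] {f g : V →ₗ[ℝ] W}
    (h : ∀ t : ℝ, finrank ℝ (LinearMap.range (f + t • g)) ≤ finrank ℝ (LinearMap.range f))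
    {z : V} (hz : f z = 0) : g z ∈ LinearMap.range f := by
  by_contra hgz
  let f' : V × ℝ →ₗ[ℝ] W := f.coprod (LinearMap.toSpanSingleton ℝ W (g z))
  let g' : V × ℝ →ₗ[ℝ] W := g ∘ₗ LinearMap.fst ℝ V ℝ
  have hlt : finrank ℝ (LinearMap.range f) < finrank ℝ (LinearMap.range f') := by
    refine Submodule.finrank_lt_finrank_of_lt (lt_of_le_of_ne ?_ ?_)
    · rintro _ ⟨v, rfl⟩
      exact ⟨(v, 0), by simp [f']⟩
    · intro heq
      exact hgz (heq ▸ ⟨(0, 1), by simp [f']⟩)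
  obtain ⟨t, ht, ht0⟩ :=
    (((f'.eventually_finrank_range_le g').filter_mono nhdsWithin_le_nhds).and
      (self_mem_nhdsWithin : {(0 : ℝ)}ᶜ ∈ 𝓝[≠] (0 : ℝ))).exists
  have ht0 : t ≠ 0 := ht0
  have hle : LinearMap.range (f' + t • g') ≤ LinearMap.range (f + t • g) := by
    rintro _ ⟨⟨v, s⟩, rfl⟩
    refine ⟨v + (s / t) • z, ?_⟩
    simp [f', g', hz, smul_smul, mul_div_cancel₀ _ ht0]
    abel
  have := Submodule.finrank_mono hle
  have := h t
  lia

end Rank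

section HermitianForm

variable {V L : Type*} [AddCommGroup V] [Module ℝ V] [AddCommGroup L] [Module ℝ L]

/-- The data that a degenerate direction of a flat Hermitian form at `X` produces: a null
vector `e` whose associated scalar form is positive semidefinite, nonzero, and vanishes on `X`. -/
structure IsDegenerateDirection (B : LinearMap.BilinForm ℝ L) (b : V →ₗ[ℝ] V →ₗ[ℝ] L)
    (X : V) (e : L) : Prop where
  ne_zero : e ≠ 0
  null : B e e = 0
  nonneg : ∀ Y, 0 ≤ B e (b Y Y)
  exists_pos : ∃ Y, 0 < B e (b Y Y)
  apply_self : B e (b X X) = 0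
  exists_eq : ∃ Z Y, b Y Z = e ∧ (b Z Z = e ∨ b Z Z = 0)

theorem exists_apply_self_ne_zero {b : V →ₗ[ℝ] V →ₗ[ℝ] L} (hs : ∀ X Y, b X Y = b Y X)
    (l : L →ₗ[ℝ] ℝ) (hl : ∃ X Y, l (b X Y) ≠ 0) : ∃ Y, l (b Y Y) ≠ 0 := by
  by_contra! h
  obtain ⟨X, Y, hXY⟩ := hl
  have h' := h (X + Y)
  simp only [map_add, LinearMap.add_apply, h X, h Y, hs Y X] at h'
  exact hXY (by linarith)

theorem eq_zero_of_nonneg_of_apply_self {b : V →ₗ[ℝ] V →ₗ[ℝ] L} (hs : ∀ X Y, b X Y = b Y X)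
    (l : L →ₗ[ℝ] ℝ) (hl : ∀ Y, 0 ≤ l (b Y Y)) {Z : V} (hZ : l (b Z Z) = 0) (Y : V) :
    l (b Y Z) = 0 := by
  by_contra hne
  have h := hl (Y - ((l (b Y Y) + 1) / (2 * l (b Y Z))) • Z)
  simp only [map_sub, map_smul, LinearMap.sub_apply, LinearMap.smul_apply, smul_eq_mul, hs Z Y,
    hZ] at h
  have hmul : (l (b Y Y) + 1) / (2 * l (b Y Z)) * l (b Y Z) = (l (b Y Y) + 1) / 2 := by
    field_simp
  linarith

theorem IsDegenerateDirection.apply_pos {B : LinearMap.BilinForm ℝ L} (hB : IsLorentzian B)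
    {b : V →ₗ[ℝ] V →ₗ[ℝ] L} (hs : ∀ X Y, b X Y = b Y X) {X₁ X₂ : V} {e₁ e₂ : L}
    (h₁ : IsDegenerateDirection B b X₁ e₁) (h₂ : IsDegenerateDirection B b X₂ e₂)
    (hX : B e₁ (b X₂ X₂) ≠ 0) : 0 < B e₁ e₂ := by
  refine lt_of_le_of_ne ?_ ?_
  · obtain ⟨Z, Y, hYZ, hZ | hZ⟩ := h₂.exists_eq
    · exact hZ ▸ h₁.nonneg Z
    · rw [← hYZ, eq_zero_of_nonneg_of_apply_self hs (B e₁) h₁.nonneg (by simp [hZ])]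
  · intro h0
    obtain ⟨k, rfl⟩ := hB.exists_eq_smul_of_orthogonal_null h₂.ne_zero h₂.null
      (by rw [hB.1, ← h0]) h₁.null
    simp [h₂.apply_self] at hX

variable {B : LinearMap.BilinForm ℝ L} {b : V →ₗ[ℝ] V →ₗ[ℝ] L} {J : V →ₗ[ℝ] V}

theorem apply_complexStructure_right (hJ : ∀ X, J (J X) = -X)
    (hb : ∀ X Y, b (J X) (J Y) = b X Y) (X Y : V) : b X (J Y) = -b (J X) Y := by
  rw [← hb X (J Y), hJ]
  simp

theorem apply_self_complexStructure (hs : ∀ X Y, b X Y = b Y X) (hJ : ∀ X, J (J X) = -X)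
    (hb : ∀ X Y, b (J X) (J Y) = b X Y) (X : V) : b X (J X) = 0 := by
  have h := apply_complexStructure_right hJ hb X X
  rw [hs (J X)] at h
  have : IsAddTorsionFree L := .of_isTorsionFree ℝ L
  exact self_eq_neg.mp h

theorem two_mul_apply_eq_of_degenerate (hs : ∀ X Y, b X Y = b Y X) (hJ : ∀ X, J (J X) = -X)
    (hb : ∀ X Y, b (J X) (J Y) = b X Y)
    (hflat : ∀ X Y Z T, B (b X Y) (b Z T) - B (b X (J Y)) (b Z (J T)) =
      B (b X T) (b Z Y) - B (b X (J T)) (b Z (J Y)))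
    {X Z : V} (hXZ : b X Z = 0) (hXJZ : b X (J Z) = 0)
    (hrange : ∀ Y, ∃ T, b Y Z = b X T ∧ b Y (J Z) = b X (J T)) (Y Y' : V) :
    2 * B (b Y Z) (b Y' Z) = B (b Y Y') (b Z Z) := by
  have hiso : B (b Y Z) (b Y' Z) = B (b Y (J Z)) (b Y' (J Z)) := by
    obtain ⟨T, hT, hT'⟩ := hrange Y'
    have h := hflat Y Z X T
    rw [hXZ, hXJZ] at h
    rw [hT, hT']
    simpa [sub_eq_zero] using h
  have h := hflat Y Z Z Y'
  rw [apply_self_complexStructure hs hJ hb Z, hs Z Y', apply_complexStructure_right hJ hb Z Y',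
    hs (J Z) Y'] at h
  simp only [map_neg, map_zero] at h
  linarith

theorem exists_isDegenerateDirection (hB : IsLorentzian B) (hs : ∀ X Y, b X Y = b Y X)
    (hJ : ∀ X, J (J X) = -X) (hb : ∀ X Y, b (J X) (J Y) = b X Y)
    (hflat : ∀ X Y Z T, B (b X Y) (b Z T) - B (b X (J Y)) (b Z (J T)) =
      B (b X T) (b Z Y) - B (b X (J T)) (b Z (J Y)))
    (hspan : ∀ e, (∀ X Y, B e (b X Y) = 0) → e = 0)
    {X Z : V} (hXZ : b X Z = 0) (hXJZ : b X (J Z) = 0)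
    (hrange : ∀ Y, ∃ T, b Y Z = b X T ∧ b Y (J Z) = b X (J T))
    (hZ : ∃ Y, b Y Z ≠ 0) : ∃ e, IsDegenerateDirection B b X e := by
  have key := two_mul_apply_eq_of_degenerate hs hJ hb hflat hXZ hXJZ hrange
  have hne {e : L} (he : e ≠ 0) : ∃ Y, B e (b Y Y) ≠ 0 := by
    refine exists_apply_self_ne_zero hs (B e) ?_
    by_contra! h
    exact he (hspan e h)
  by_cases he : b Z Z = 0
  · obtain ⟨Y₀, hY₀⟩ := hZ
    have hnull (Y Y' : V) : B (b Y Z) (b Y' Z) = 0 := by simpa [he] using key Y Y'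
    set e := b Y₀ Z with he_def
    have hψ (Y : V) : ∃ k : ℝ, b Y Z = k • e :=
      hB.exists_eq_smul_of_orthogonal_null hY₀ (hnull _ _) (hnull _ _) (hnull _ _)
    choose ψ hψ using hψ
    have hψJ (Y : V) : b Y (J Z) = -ψ (J Y) • e := by
      rw [apply_complexStructure_right hJ hb, hψ, neg_smul]
    have hinj {k l : ℝ} (h : k • e = l • e) : k = l := smul_left_injective ℝ hY₀ h
    have hψ₀ : ψ Y₀ = 1 := hinj (by rw [← hψ, one_smul])
    have hψX : ψ X = 0 := hinj (by rw [← hψ, hXZ, zero_smul])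
    have hψJX : ψ (J X) = 0 := neg_eq_zero.mp (hinj (by rw [← hψJ, hXJZ, zero_smul]))
    have hflat' (Y Y' T : V) : ψ Y * B e (b Y' T) + ψ (J Y) * B e (b Y' (J T)) =
        ψ Y' * B e (b Y T) + ψ (J Y') * B e (b Y (J T)) := by
      have h := hflat Y Z Y' T
      simp only [hψ, hψJ, map_smul, LinearMap.smul_apply, smul_eq_mul, hB.1 _ e] at h
      linarith
    obtain ⟨Y₁, hY₁, hJY₁⟩ : ∃ Y, ψ Y = 1 ∧ ψ (J Y) = 0 := by
      set s := ψ (J Y₀) with hs_def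
      have hpos : (1 + s ^ 2) ≠ 0 := by positivity
      refine ⟨(1 / (1 + s ^ 2)) • (Y₀ + s • J Y₀), hinj ?_, hinj ?_⟩
      · rw [← hψ]
        simp only [map_add, map_smul, LinearMap.add_apply, LinearMap.smul_apply, hψ, hψ₀,
          ← hs_def, smul_smul, ← add_smul]
        congr 1
        field_simp
      · rw [← hψ]
        simp only [map_add, map_smul, LinearMap.add_apply, LinearMap.smul_apply, hψ, hJ, map_neg,
          LinearMap.neg_apply, hψ₀, ← hs_def, smul_smul, ← add_smul, ← neg_smul]
        congr 1
        ring
    set c := B e (b Y₁ Y₁) with hc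
    have hrow (T : V) : B e (b Y₁ T) = c * ψ T := by
      have h := hflat' Y₁ T Y₁
      rw [apply_self_complexStructure hs hJ hb, hY₁, hJY₁, hs T Y₁, ← hc] at h
      simp only [map_zero] at h
      linarith
    have hq (Y : V) : B e (b Y Y) = c * (ψ Y ^ 2 + ψ (J Y) ^ 2) := by
      have h := hflat' Y₁ Y Y
      rw [hY₁, hJY₁, hrow, hrow] at h
      linarith
    have hqX : B e (b X X) = 0 := by rw [hq, hψX, hψJX]; ring
    obtain ⟨Y₂, hY₂⟩ := hne hY₀
    rcases le_total 0 c with h0 | h0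
    · have hnonneg (Y : V) : 0 ≤ B e (b Y Y) := by rw [hq]; positivity
      exact ⟨e, hY₀, hnull _ _, hnonneg, ⟨Y₂, (hnonneg _).lt_of_ne' hY₂⟩, hqX, Z, Y₀, rfl,
        Or.inr he⟩
    · have hnonneg (Y : V) : 0 ≤ B (-e) (b Y Y) := by
        rw [map_neg, LinearMap.neg_apply, hq, ← neg_mul]
        exact mul_nonneg (by linarith) (by positivity)
      exact ⟨-e, neg_ne_zero.mpr hY₀, by simpa using hnull Y₀ Y₀, hnonneg,
        ⟨Y₂, (hnonneg _).lt_of_ne' (by simpa using hY₂)⟩, by simpa using hqX, Z, -Y₀,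
        by simp [he_def], Or.inr he⟩
  · have horth (Y : V) : B (b Z Z) (b Y Z) = 0 := by
      have h := key Y Z
      rw [hB.1 (b Z Z)]
      linarith
    have hq (Y : V) : B (b Z Z) (b Y Y) = 2 * B (b Y Z) (b Y Z) := by rw [hB.1, key]
    have hnonneg (Y : V) : 0 ≤ B (b Z Z) (b Y Y) := by
      rw [hq]
      linarith [hB.nonneg_of_orthogonal_null he (horth Z) (horth Y)]
    obtain ⟨Y₂, hY₂⟩ := hne he
    exact ⟨b Z Z, he, horth Z, hnonneg, ⟨Y₂, (hnonneg _).lt_of_ne' hY₂⟩,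
      by rw [hq, hXZ]; simp, Z, Z, rfl, Or.inl rfl⟩

theorem eventually_apply_add_smul_ne_zero (l : L →ₗ[ℝ] ℝ) {X : V} (hX : l (b X X) ≠ 0) (Y : V) :
    ∀ᶠ t in 𝓝[≠] (0 : ℝ), l (b (X + t • Y) (X + t • Y)) ≠ 0 := by
  refine Filter.Eventually.filter_mono nhdsWithin_le_nhds ?_
  have hcont : Continuous fun t : ℝ ↦ l (b (X + t • Y) (X + t • Y)) := by
    simp only [map_add, map_smul, LinearMap.add_apply, LinearMap.smul_apply, smul_eq_mul]
    fun_prop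
  exact hcont.continuousAt.eventually_ne (by simpa using hX)

theorem IsDegenerateDirection.eventually_ne_zero (hs : ∀ X Y, b X Y = b Y X) {X : V} {e : L}
    (h : IsDegenerateDirection B b X e) {Y : V} (hY : 0 < B e (b Y Y)) :
    ∀ᶠ t in 𝓝[≠] (0 : ℝ), B e (b (X + t • Y) (X + t • Y)) ≠ 0 := by
  filter_upwards [self_mem_nhdsWithin] with t ht
  have ht : t ≠ 0 := ht
  have hYX := eq_zero_of_nonneg_of_apply_self hs (B e) h.nonneg h.apply_self Y
  simp only [map_add, map_smul, LinearMap.add_apply, LinearMap.smul_apply, smul_eq_mul, hs X Y,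
    hYX, h.apply_self, mul_zero, zero_add, add_zero]
  positivity

/-- A nonempty set that is open along lines contains a point without degenerate directions. -/
theorem exists_not_isDegenerateDirection (hB : IsLorentzian B) (hs : ∀ X Y, b X Y = b Y X)
    {S : Set V} (hne : S.Nonempty) (hS : ∀ X ∈ S, ∀ Y, ∀ᶠ t in 𝓝[≠] (0 : ℝ), X + t • Y ∈ S) :
    ∃ X ∈ S, ∀ e, ¬ IsDegenerateDirection B b X e := by
  by_contra! h
  obtain ⟨X₁, hX₁⟩ := hne
  obtain ⟨e₁, h₁⟩ := h X₁ hX₁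
  obtain ⟨Y₁, hY₁⟩ := h₁.exists_pos
  obtain ⟨t, ht, hX₂⟩ := ((h₁.eventually_ne_zero hs hY₁).and (hS X₁ hX₁ Y₁)).exists
  obtain ⟨e₂, h₂⟩ := h _ hX₂
  obtain ⟨Y₂, hY₂⟩ := h₂.exists_pos
  obtain ⟨s, ⟨hs₂, hs₁⟩, hX₃⟩ := (((h₂.eventually_ne_zero hs hY₂).and
    (eventually_apply_add_smul_ne_zero (B e₁) ht Y₂)).and (hS _ hX₂ Y₂)).exists
  obtain ⟨e₃, h₃⟩ := h _ hX₃
  exact hB.not_three_null_pos h₁.null h₂.null h₃.null (h₁.apply_pos hB hs h₂ ht)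
    (h₁.apply_pos hB hs h₃ hs₁) (h₂.apply_pos hB hs h₃ hs₂)

end HermitianForm

section Regular

variable {V W : Type*} [AddCommGroup V] [Module ℝ V] [AddCommGroup W] [Module ℝ W]

/-- The elements `X` for which `β X` has maximal rank. -/
def regularElements (β : V →ₗ[ℝ] V →ₗ[ℝ] W) : Set V :=
  {X | ∀ Z, finrank ℝ (LinearMap.range (β Z)) ≤ finrank ℝ (LinearMap.range (β X))}

theorem regularElements_nonempty [FiniteDimensional ℝ W] (β : V →ₗ[ℝ] V →ₗ[ℝ] W) :
    (regularElements β).Nonempty := by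
  have hfin : (Set.range fun X ↦ finrank ℝ (LinearMap.range (β X))).Finite :=
    (Set.finite_Iic (finrank ℝ W)).subset
      (by rintro _ ⟨X, rfl⟩; exact Submodule.finrank_le _)
  obtain ⟨_, ⟨X, rfl⟩, hX⟩ := Set.exists_max_image _ id hfin (Set.range_nonempty _)
  exact ⟨X, fun Z ↦ hX _ ⟨Z, rfl⟩⟩

theorem eventually_mem_regularElements [FiniteDimensional ℝ V] {β : V →ₗ[ℝ] V →ₗ[ℝ] W}
    {X : V} (hX : X ∈ regularElements β) (Y : V) :
    ∀ᶠ t in 𝓝[≠] (0 : ℝ), X + t • Y ∈ regularElements β := by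
  filter_upwards [((β X).eventually_finrank_range_le (β Y)).filter_mono nhdsWithin_le_nhds]
    with t ht Z
  rw [map_add, map_smul]
  exact (hX Z).trans ht

theorem apply_mem_range_of_mem_regularElements [FiniteDimensional ℝ V] [FiniteDimensional ℝ W]
    {β : V →ₗ[ℝ] V →ₗ[ℝ] W} {X Z : V} (hX : X ∈ regularElements β) (hZ : β X Z = 0) (Y : V) :
    β Y Z ∈ LinearMap.range (β X) := by
  refine LinearMap.mem_range_of_finrank_range_le (fun t ↦ ?_) hZ
  rw [← map_smul, ← map_add]
  exact hX _

end Regular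

/-- If β is surjective and flat with p ≤ n then dim N(β) ≥ 2n − 2p; moreover
if N(β) = 0 then β_X is an isomorphism for every regular X. -/
theorem stmt_8 (n p : ℕ) (V L : Type*) [AddCommGroup V] [Module ℝ V] [FiniteDimensional ℝ V]
    [AddCommGroup L] [Module ℝ L] [FiniteDimensional ℝ L]
    (hdV : Module.finrank ℝ V = 2 * n) (hdL : Module.finrank ℝ L = p) (hpn : p ≤ n)
    (BL : LinearMap.BilinForm ℝ L) (hLsymm : BL.IsSymm)
    (hLor : ∃ w : L, BL w w = -1 ∧ ∀ x : L, BL x w = 0 → x ≠ 0 → 0 < BL x x)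
    (J : V →ₗ[ℝ] V) (hJ : J ∘ₗ J = -LinearMap.id)
    (α : V →ₗ[ℝ] V →ₗ[ℝ] L) (hαsymm : ∀ X Y : V, α X Y = α Y X)
    (β : V →ₗ[ℝ] V →ₗ[ℝ] L × L)
    (hβ : ∀ X Y : V, β X Y = (α X Y + α (J X) (J Y), α X (J Y) - α (J X) Y))
    (Bw : LinearMap.BilinForm ℝ (L × L))
    (hBw : ∀ a b : L × L, Bw a b = BL a.1 b.1 - BL a.2 b.2)
    (hflat : ∀ X Y Z T : V, Bw (β X Y) (β Z T) = Bw (β X T) (β Z Y))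
    (hsurj : Submodule.span ℝ {z : L × L | ∃ X Y : V, z = β X Y} = ⊤) :
    2 * n - 2 * p ≤ Module.finrank ℝ ↥(⨅ X : V, LinearMap.ker (β X)) ∧
    ((⨅ X : V, LinearMap.ker (β X)) = ⊥ → ∀ X : V,
      (∀ Z : V, Module.finrank ℝ (LinearMap.range (β Z)) ≤
        Module.finrank ℝ (LinearMap.range (β X))) →
      Function.Bijective (β X)) := by
  have hJJ (X : V) : J (J X) = -X := LinearMap.congr_fun hJ X
  let b : V →ₗ[ℝ] V →ₗ[ℝ] L := α + α.compl₁₂ J J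
  have hb (X Y : V) : b X Y = α X Y + α (J X) (J Y) := rfl
  have hs (X Y : V) : b X Y = b Y X := by rw [hb, hb, hαsymm X, hαsymm (J X)]
  have hbJ (X Y : V) : b (J X) (J Y) = b X Y := by simp [hb, hJJ, add_comm]
  have hβb (X Y : V) : β X Y = (b X Y, b X (J Y)) := by
    simp [hβ, hb, hJJ, sub_eq_add_neg]
  have hB : IsLorentzian BL := ⟨fun x y ↦ by simpa using hLsymm.eq x y, hLor⟩
  have hflat' (X Y Z T : V) : BL (b X Y) (b Z T) - BL (b X (J Y)) (b Z (J T)) =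
      BL (b X T) (b Z Y) - BL (b X (J T)) (b Z (J Y)) := by
    simpa only [hBw, hβb] using hflat X Y Z T
  have hspan (e : L) (he : ∀ X Y, BL e (b X Y) = 0) : e = 0 := by
    have hzero (x : L) : BL e x = 0 := by
      have hle : Submodule.span ℝ {z : L × L | ∃ X Y : V, z = β X Y} ≤
          LinearMap.ker (BL e ∘ₗ LinearMap.fst ℝ L L) := by
        rw [Submodule.span_le]
        rintro _ ⟨X, Y, rfl⟩
        simp [hβb, he]
      rw [hsurj] at hle
      simpa using hle (Submodule.mem_top (x := (x, 0)))
    obtain ⟨w, -, hw⟩ := hLor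
    by_contra hne
    exact (hw e (hzero w) hne).ne' (hzero e)
  obtain ⟨X₀, hX₀, hdeg⟩ := exists_not_isDegenerateDirection hB hs (regularElements_nonempty β)
    fun X hX Y ↦ eventually_mem_regularElements hX Y
  have hker : LinearMap.ker (β X₀) = ⨅ X : V, LinearMap.ker (β X) := by
    refine le_antisymm (fun Z hZ ↦ ?_) (iInf_le _ X₀)
    rw [LinearMap.mem_ker] at hZ
    have hZ' := hZ
    rw [hβb, Prod.mk_eq_zero] at hZ'
    by_contra hN
    refine absurd (exists_isDegenerateDirection hB hs hJJ hbJ hflat' hspan hZ'.1 hZ'.2 ?_ ?_)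
      (not_exists.mpr hdeg)
    · intro Y
      obtain ⟨T, hT⟩ := apply_mem_range_of_mem_regularElements hX₀ hZ Y
      rw [hβb, hβb, Prod.mk.injEq] at hT
      exact ⟨T, hT.1.symm, hT.2.symm⟩
    · by_contra! h
      refine hN ((Submodule.mem_iInf _).mpr fun Y ↦ ?_)
      simp [hβb, h, apply_complexStructure_right hJJ hbJ Y Z]
  have hdim := (β X₀).finrank_range_add_finrank_ker
  have hW : finrank ℝ (L × L) = 2 * p := by rw [finrank_prod, hdL, two_mul]
  have hle : finrank ℝ (LinearMap.range (β X₀)) ≤ 2 * p := hW ▸ Submodule.finrank_le _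
  rw [← hker]
  refine ⟨by lia, fun hbot X hX ↦ ?_⟩
  rw [hbot, finrank_bot] at hdim
  have hrank := hX X₀
  have hleX : finrank ℝ (LinearMap.range (β X)) ≤ 2 * p := hW ▸ Submodule.finrank_le _
  have hsurjX : LinearMap.range (β X) = ⊤ := Submodule.eq_top_of_finrank_eq (by lia)
  have hinjX : LinearMap.ker (β X) = ⊥ := by
    rw [← Submodule.finrank_eq_zero (R := ℝ)]
    have := (β X).finrank_range_add_finrank_ker
    lia
  exact ⟨LinearMap.ker_eq_bot.mp hinjX, LinearMap.range_eq_top.mp hsurjX⟩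
end

section
/- Under the same hypotheses (β flat, S(β) degenerate, s ≤ n−1, compatibility between β and γ), there exists a J-invariant subspace P of V^{2n} of dimension 2m with m ≥ n − s + 1 such that for every S ∈ P: ⟨α(S,S),α(JS,JS)⟩ − ‖α(S,JS)‖² ≤ 0, and for any orthonormal basis {X_i} of V^{2n}, Σ_i (⟨α(X_i,X_i),α(S,S)⟩ − ‖α(X_i,S)‖²) ≤ 0. -/
/-- In a Lorentzian space, the orthogonal complement of a nonzero null vector `v` is positive
semidefinite, and its null vectors are multiples of `v`. -/
theorem lorentz_orthogonal_null {L : Type*} [AddCommGroup L] [Module ℝ L]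
    {B : LinearMap.BilinForm ℝ L} (hB : B.IsSymm) {w : L}
    (hLor : ∀ x : L, B x w = 0 → x ≠ 0 → 0 < B x x)
    {v : L} (hvv : B v v = 0) (hvw : B v w = -1) {x : L} (hxv : B x v = 0) :
    0 ≤ B x x ∧ (B x x = 0 → x ∈ Submodule.span ℝ {v}) := by
  have hvx : B v x = 0 := (hB.eq v x).trans hxv
  have hy : B (x + B x w • v) w = 0 := by simp [hvw]
  have hq : B (x + B x w • v) (x + B x w • v) = B x x := by simp [hvv, hxv, hvx]
  by_cases h0 : x + B x w • v = 0
  · refine ⟨by rw [← hq, h0]; simp, fun _ => ?_⟩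
    rw [Submodule.mem_span_singleton]
    exact ⟨-B x w, by rw [neg_smul]; exact (eq_neg_of_add_eq_zero_left h0).symm⟩
  · have := hLor _ hy h0
    rw [hq] at this
    exact ⟨this.le, fun h => absurd h this.ne'⟩

/-- A finite-dimensional real vector space with a complex structure has even dimension. -/
theorem even_finrank_of_complex_structure {P : Type*} [AddCommGroup P] [Module ℝ P]
    [FiniteDimensional ℝ P] (J : P →ₗ[ℝ] P) (hJ : J ∘ₗ J = -LinearMap.id) :
    Even (Module.finrank ℝ P) := by
  have h := congrArg LinearMap.det hJ
  rw [LinearMap.det_comp, ← neg_one_smul ℝ (LinearMap.id : P →ₗ[ℝ] P), LinearMap.det_smul,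
    LinearMap.det_id, mul_one] at h
  by_contra hodd
  rw [Nat.not_even_iff_odd] at hodd
  rw [hodd.neg_one_pow] at h
  nlinarith [mul_self_nonneg (LinearMap.det J)]

/-- If `f` takes values in `A × A` and `v ∈ A` is nonzero, then the preimage of
`span v × span v` has codimension at most `2 (dim A - 1)`. -/
theorem finrank_comap_span_prod {V L : Type*} [AddCommGroup V] [Module ℝ V]
    [FiniteDimensional ℝ V] [AddCommGroup L] [Module ℝ L] [FiniteDimensional ℝ L]
    (f : V →ₗ[ℝ] L × L) (A : Submodule ℝ L) (hf : ∀ x, (f x).1 ∈ A ∧ (f x).2 ∈ A)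
    {v : L} (hv : v ∈ A) (hv0 : v ≠ 0) :
    Module.finrank ℝ V + 2 ≤ Module.finrank ℝ
      (Submodule.comap f ((Submodule.span ℝ {v}).prod (Submodule.span ℝ {v})))
      + 2 * Module.finrank ℝ A := by
  let v' : A := ⟨v, hv⟩
  have hv' : v' ≠ 0 := fun h => hv0 (congrArg Subtype.val h)
  let Q := Submodule.span ℝ {v'}
  let g : V →ₗ[ℝ] (A ⧸ Q) × (A ⧸ Q) :=
    (Q.mkQ ∘ₗ ((LinearMap.fst ℝ L L ∘ₗ f).codRestrict A fun x => (hf x).1)).prod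
      (Q.mkQ ∘ₗ ((LinearMap.snd ℝ L L ∘ₗ f).codRestrict A fun x => (hf x).2))
  have hmem : ∀ y : A, y ∈ Q → (y : L) ∈ Submodule.span ℝ {v} := by
    intro y hy
    obtain ⟨c, rfl⟩ := Submodule.mem_span_singleton.1 hy
    exact Submodule.mem_span_singleton.2 ⟨c, rfl⟩
  have hker : LinearMap.ker g ≤
      Submodule.comap f ((Submodule.span ℝ {v}).prod (Submodule.span ℝ {v})) := by
    intro x hx
    have hx' : g x = 0 := hx
    have h1 := congrArg Prod.fst hx'
    have h2 := congrArg Prod.snd hx'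
    exact ⟨hmem _ ((Submodule.Quotient.mk_eq_zero Q).1 h1),
      hmem _ ((Submodule.Quotient.mk_eq_zero Q).1 h2)⟩
  have h1 := Submodule.finrank_mono hker
  have h2 := g.finrank_range_add_finrank_ker
  have h3 := Submodule.finrank_le (LinearMap.range g)
  have h4 := Q.finrank_quotient_add_finrank
  have h5 : Module.finrank ℝ Q = 1 := finrank_span_singleton hv'
  rw [Module.finrank_prod] at h3
  omega

/-- An orthonormal basis and its image under an orthogonal complex structure have the same
trace against a bilinear form, so the trace vanishes if the form is anti-invariant. -/
theorem sum_eq_zero_of_anti_invariant {V ι : Type*} [AddCommGroup V] [Module ℝ V] [Fintype ι]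
    [DecidableEq ι] {BV : LinearMap.BilinForm ℝ V} (hVsymm : BV.IsSymm)
    {J : V →ₗ[ℝ] V} (hJJ : ∀ X, J (J X) = -X) (hJskew : ∀ X Y, BV (J X) Y = -BV X (J Y))
    (f : V →ₗ[ℝ] V →ₗ[ℝ] ℝ) (hf : ∀ X, f X X + f (J X) (J X) = 0) {b : ι → V}
    (hb : ∀ i j, BV (b i) (b j) = if i = j then 1 else 0)
    (hspan : Submodule.span ℝ (Set.range b) = ⊤) :
    ∑ i, f (b i) (b i) = 0 := by
  have hexp : ∀ X, X = ∑ j, BV (b j) X • b j := by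
    intro X
    have hX : X ∈ Submodule.span ℝ (Set.range b) := hspan ▸ Submodule.mem_top
    obtain ⟨c, rfl⟩ := (Submodule.mem_span_range_iff_exists_fun ℝ).1 hX
    simp [hb]
  have hs : ∀ X Y, BV X Y = BV Y X := fun X Y => hVsymm.eq X Y
  have key : ∑ i, f (J (b i)) (J (b i)) = ∑ j, f (b j) (b j) := by
    calc ∑ i, f (J (b i)) (J (b i))
        = ∑ i, ∑ j, BV (b j) (J (b i)) * f (b j) (J (b i)) := by
          refine Finset.sum_congr rfl fun i _ => ?_
          conv_lhs => rw [show f (J (b i)) = f (∑ j, BV (b j) (J (b i)) • b j) from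
            congrArg f (hexp _)]
          simp
      _ = ∑ j, ∑ i, BV (b j) (J (b i)) * f (b j) (J (b i)) := Finset.sum_comm
      _ = ∑ j, f (b j) (b j) := by
          refine Finset.sum_congr rfl fun j _ => ?_
          have h : b j = J (∑ i, BV (b j) (J (b i)) • b i) := by
            have : ∑ i, BV (b j) (J (b i)) • b i = -J (b j) := by
              conv_rhs => rw [hexp (J (b j))]
              rw [← Finset.sum_neg_distrib]
              refine Finset.sum_congr rfl fun i _ => ?_
              rw [hs (b i), hJskew, neg_smul, neg_neg]
            rw [this, map_neg, hJJ, neg_neg]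
          conv_rhs => rw [show f (b j) (b j) = f (b j) (J (∑ i, BV (b j) (J (b i)) • b i)) from
            congrArg (f (b j)) h]
          simp
  have h0 : ∑ i, (f (b i) (b i) + f (J (b i)) (J (b i))) = 0 :=
    Finset.sum_eq_zero fun i _ => hf _
  rw [Finset.sum_add_distrib, key] at h0
  linarith


theorem stmt_14 (n : ℕ) (V L : Type*) [AddCommGroup V] [Module ℝ V] [FiniteDimensional ℝ V]
    [AddCommGroup L] [Module ℝ L] [FiniteDimensional ℝ L]
    (hdV : Module.finrank ℝ V = 2 * n)
    (BV : LinearMap.BilinForm ℝ V) (hVsymm : BV.IsSymm)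
    (hVpos : ∀ X : V, X ≠ 0 → 0 < BV X X)
    (J : V →ₗ[ℝ] V) (hJ : J ∘ₗ J = -LinearMap.id)
    (hJiso : ∀ X Y : V, BV (J X) (J Y) = BV X Y)
    (BL : LinearMap.BilinForm ℝ L) (hLsymm : BL.IsSymm)
    (w : L) (hw : BL w w = -1)
    (hLor : ∀ x : L, BL x w = 0 → x ≠ 0 → 0 < BL x x)
    (α : V →ₗ[ℝ] V →ₗ[ℝ] L) (hαsymm : ∀ X Y : V, α X Y = α Y X)
    (hαw : ∀ X Y : V, BL (α X Y) w = -(BV X Y))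
    (β : V →ₗ[ℝ] V →ₗ[ℝ] L × L)
    (hβ : ∀ X Y : V, β X Y = (α X Y + α (J X) (J Y), α X (J Y) - α (J X) Y))
    (Bw : LinearMap.BilinForm ℝ (L × L))
    (hBw : ∀ a b : L × L, Bw a b = BL a.1 b.1 - BL a.2 b.2)
    (hflat : ∀ X Y Z T : V, Bw (β X Y) (β Z T) = Bw (β X T) (β Z Y))
    (γ : V → V → L × L) (hγ : ∀ X Y : V, γ X Y = (α X Y, α X (J Y)))
    (hcompat : ∀ X Y Z T : V, Bw (β X Y) (γ Z T) = Bw (β X T) (γ Z Y))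
    (Sβ : Submodule ℝ (L × L))
    (hSβ : Sβ = Submodule.span ℝ {z : L × L | ∃ X Y : V, z = β X Y})
    (hdeg : Sβ ⊓ Bw.orthogonal Sβ ≠ ⊥)
    (s : ℕ) (hs : s = Module.finrank ℝ (Submodule.map (LinearMap.fst ℝ L L) Sβ))
    (hsn : s ≤ n - 1)
    :
    ∃ (P : Submodule ℝ V) (m : ℕ),
      (∀ S ∈ P, J S ∈ P) ∧
      Module.finrank ℝ P = 2 * m ∧
      n - s + 1 ≤ m ∧
      ∀ S ∈ P,
        (BL (α S S) (α (J S) (J S)) - BL (α S (J S)) (α S (J S)) ≤ 0) ∧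
        (∀ b : Fin (2 * n) → V,
          (∀ i j, BV (b i) (b j) = if i = j then 1 else 0) →
          Submodule.span ℝ (Set.range b) = ⊤ →
          (∑ i, (BL (α (b i) (b i)) (α S S) - BL (α (b i) S) (α (b i) S))) ≤ 0) := by
  have hJJ : ∀ X, J (J X) = -X := fun X => by simpa using LinearMap.congr_fun hJ X
  have hVs : ∀ X Y, BV X Y = BV Y X := fun X Y => hVsymm.eq X Y
  have hLs : ∀ x y, BL x y = BL y x := fun x y => hLsymm.eq x y
  have hJskew : ∀ X Y, BV (J X) Y = -BV X (J Y) := by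
    intro X Y
    rw [← hJiso (J X) Y, hJJ]; simp
  set A := Submodule.map (LinearMap.fst ℝ L L) Sβ with hA
  have hβS : ∀ X Y, β X Y ∈ Sβ := fun X Y => hSβ ▸ Submodule.subset_span ⟨X, Y, rfl⟩
  have hβ2 : ∀ X Y, (β X Y).2 = (β X (J Y)).1 := by
    intro X Y; simp [hβ, hJJ, sub_eq_add_neg]
  have hβJ2 : ∀ X Y, (β X (J Y)).2 = -(β X Y).1 := by
    intro X Y; simp [hβ, hJJ]; abel
  have hsw1 : ∀ X Y, (β Y X).1 = (β X Y).1 := by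
    intro X Y; simp [hβ, hαsymm Y X, hαsymm (J Y) (J X)]
  have hsw2 : ∀ X Y, (β Y X).2 = -(β X Y).2 := by
    intro X Y; simp [hβ, hαsymm Y (J X), hαsymm (J Y) X]
  have hβA1 : ∀ X Y, (β X Y).1 ∈ A := fun X Y => ⟨_, hβS X Y, rfl⟩
  have hβA2 : ∀ X Y, (β X Y).2 ∈ A := fun X Y => hβ2 X Y ▸ hβA1 X (J Y)
  have hSA2 : ∀ z ∈ Sβ, z.2 ∈ A := by
    have : Sβ ≤ A.comap (LinearMap.snd ℝ L L) := by
      conv_lhs => rw [hSβ]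
      rw [Submodule.span_le]
      rintro z ⟨X, Y, rfl⟩
      exact hβA2 X Y
    exact this
  have hAperp : ∀ u, (∀ X Y, BL (β X Y).1 u = 0) → ∀ x ∈ A, BL x u = 0 := by
    intro u hu
    have : A ≤ LinearMap.ker (BL.flip u) := by
      rw [hA, Submodule.map_le_iff_le_comap]
      conv_lhs => rw [hSβ]
      rw [Submodule.span_le]
      rintro z ⟨X, Y, rfl⟩
      exact hu X Y
    exact this
  -- a generator of the radical of `A`
  obtain ⟨v, hvA, hv0, hvβ⟩ : ∃ v ∈ A, v ≠ 0 ∧ ∀ X Y, BL (β X Y).1 v = 0 := by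
    obtain ⟨z, ⟨hzS, hzo⟩, hz0⟩ := Submodule.exists_mem_ne_zero_of_ne_bot hdeg
    have ho : ∀ X Y, BL (β X Y).1 z.1 - BL (β X Y).2 z.2 = 0 := fun X Y => by
      rw [← hBw]; exact hzo _ (hβS X Y)
    have h1 : ∀ X Y, BL (β X Y).1 z.1 = 0 := by
      intro X Y
      have e1 := ho X Y
      have e2 := ho Y X
      rw [hsw1, hsw2] at e2
      simp at e2
      linarith
    have h2 : ∀ X Y, BL (β X Y).1 z.2 = 0 := by
      intro X Y
      have e := ho X (J Y)
      rw [h1, hβJ2] at e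
      simpa using e
    by_cases hz1 : z.1 = 0
    · exact ⟨z.2, hSA2 z hzS, fun h => hz0 (Prod.ext hz1 h), h2⟩
    · exact ⟨z.1, ⟨z, hzS, rfl⟩, hz1, h1⟩
  obtain ⟨v, hvA, hvβ, hvw⟩ : ∃ v ∈ A, (∀ X Y, BL (β X Y).1 v = 0) ∧ BL v w = -1 := by
    have hvw : BL v w ≠ 0 := fun h => (hLor v h hv0).ne' (hAperp v hvβ v hvA)
    refine ⟨(-(BL v w)⁻¹) • v, A.smul_mem _ hvA, fun X Y => by simp [hvβ], ?_⟩
    simp [hvw]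
  have hv0 : v ≠ 0 := by rintro rfl; simp at hvw
  have hperp := hAperp v hvβ
  have hvv := hperp v hvA
  have hpos : ∀ x, BL x v = 0 → 0 ≤ BL x x :=
    fun x hx => (lorentz_orthogonal_null hLsymm hLor hvv hvw hx).1
  have hnull : ∀ x ∈ A, BL x x = 0 → x ∈ Submodule.span ℝ {v} :=
    fun x hx => (lorentz_orthogonal_null hLsymm hLor hvv hvw (hperp x hx)).2
  have hspan0 : ∀ x ∈ Submodule.span ℝ {v}, ∀ y, BL y v = 0 → BL x y = 0 := by
    intro x hx y hy
    obtain ⟨c, rfl⟩ := Submodule.mem_span_singleton.1 hx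
    simp [hLs v y, hy]
  set I := Submodule.span ℝ {v}
  have hIA : I ≤ A := (Submodule.span_singleton_le_iff_mem v A).2 hvA
  let K : V → Submodule ℝ V := fun X => Submodule.comap (β X) (I.prod I)
  have hK : ∀ X Y, Y ∈ K X ↔ (β X Y).1 ∈ I ∧ (β X Y).2 ∈ I := fun X Y => Iff.rfl
  have hBwI : ∀ p q, p.1 ∈ I → p.2 ∈ I → q.1 ∈ A → q.2 ∈ A → Bw p q = 0 := by
    intro p q h1 h2 h3 h4
    rw [hBw, hspan0 _ h1 _ (hperp _ h3), hspan0 _ h2 _ (hperp _ h4), sub_zero]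
  have hsum : ∀ p q : L, p ∈ A → q ∈ A → BL p p + BL q q = 0 → p ∈ I ∧ q ∈ I := by
    intro p q hp hq h
    have h1 := hpos p (hperp p hp)
    have h2 := hpos q (hperp q hq)
    exact ⟨hnull p hp (by linarith), hnull q hq (by linarith)⟩
  obtain ⟨X₀, hX₀⟩ : ∃ X, ∀ Y, Module.finrank ℝ (K X) ≤ Module.finrank ℝ (K Y) :=
    ⟨Function.argmin fun X => Module.finrank ℝ (K X), fun Y =>
      Function.argmin_le (fun X => Module.finrank ℝ (K X)) Y⟩
  have hdiag : ∀ Y ∈ K X₀, (β Y Y).1 ∈ I ∧ (β Y Y).2 ∈ I := by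
    intro Y hY
    have hle : K (X₀ + Y) ≤ K X₀ := by
      intro T hT
      rw [hK] at hT
      rw [map_add, LinearMap.add_apply, Prod.fst_add, Prod.snd_add] at hT
      have hcross := hflat X₀ T T Y
      rw [hBwI (β X₀ Y) (β T T) hY.1 hY.2 (hβA1 T T) (hβA2 T T), hBw, hsw1 Y T, hsw2 Y T] at hcross
      have q1 := hspan0 _ hT.1 _ (hperp _ (hIA hT.1))
      have q2 := hspan0 _ hT.2 _ (hperp _ (hIA hT.2))
      have p1 := hpos _ (hperp _ (hβA1 X₀ T))
      have p2 := hpos _ (hperp _ (hβA2 X₀ T))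
      have p3 := hpos _ (hperp _ (hβA1 Y T))
      have p4 := hpos _ (hperp _ (hβA2 Y T))
      simp only [map_add, LinearMap.add_apply, map_neg] at q1 q2 hcross
      rw [hLs (β Y T).1 (β X₀ T).1] at q1
      rw [hLs (β Y T).2 (β X₀ T).2] at q2
      exact hsum _ _ (hβA1 _ _) (hβA2 _ _) (by linarith)
    have heq := Submodule.eq_of_le_of_finrank_le hle (hX₀ _)
    have hY' : Y ∈ K (X₀ + Y) := heq ▸ hY
    rw [hK, map_add, LinearMap.add_apply, Prod.fst_add, Prod.snd_add] at hY'
    exact ⟨(I.add_mem_iff_right hY.1).1 hY'.1, (I.add_mem_iff_right hY.2).1 hY'.2⟩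
  have hker : ∀ Y ∈ K X₀, ∀ Z, (β Z Y).1 ∈ I ∧ (β Z Y).2 ∈ I := by
    intro Y hY Z
    have h := hflat Y Y Z Z
    rw [hBwI (β Y Y) (β Z Z) (hdiag Y hY).1 (hdiag Y hY).2 (hβA1 Z Z) (hβA2 Z Z), hBw, hsw1 Z Y,
      hsw2 Z Y] at h
    refine hsum _ _ (hβA1 _ _) (hβA2 _ _) ?_
    simp only [map_neg, LinearMap.neg_apply] at h
    linarith
  have hPJ : ∀ S ∈ K X₀, J S ∈ K X₀ := by
    intro S hS
    exact ⟨hβ2 X₀ S ▸ hS.2, by rw [hβJ2]; exact I.neg_mem hS.1⟩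
  have hβ1 : ∀ S ∈ K X₀, ∀ X, (β X S).1 = (2 * BV X S) • v := by
    intro S hS X
    obtain ⟨c, hc⟩ := Submodule.mem_span_singleton.1 (hker S hS X).1
    have h : BL (β X S).1 w = -(2 * BV X S) := by
      simp [hβ, hαw, hJiso]; ring
    rw [← hc] at h ⊢
    simp [hvw] at h
    rw [h]
  have hdim := finrank_comap_span_prod (β X₀) A (fun Y => ⟨hβA1 _ _, hβA2 _ _⟩) hvA hv0
  change _ ≤ Module.finrank ℝ (K X₀) + _ at hdim
  have hspos : 0 < Module.finrank ℝ A :=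
    Module.finrank_pos_iff_exists_ne_zero.2 ⟨⟨v, hvA⟩, fun h => hv0 (congrArg Subtype.val h)⟩
  obtain ⟨m, hm⟩ := even_finrank_of_complex_structure (J.restrict hPJ)
    (LinearMap.ext fun x => Subtype.ext (hJJ x))
  -- `⟨v, α⟩` is supported on `span {S, J S}` for each nonzero `S` in the kernel
  have hαv : ∀ S ∈ K X₀, ∀ Z T, BV S S * BL v (α Z T) =
      BV S T * BL v (α Z S) + BV T (J S) * BL v (α Z (J S)) := by
    intro S hS Z T
    have h := hcompat S S Z T
    rw [hBw, hBw, hγ, hγ, hβ2 S S, hβ1 S hS, hβ1 (J S) (hPJ S hS), ← hsw1 S T, ← neg_neg (β S T).2,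
      ← hsw2 S T, hβ2 T S, hβ1 S hS, hβ1 (J S) (hPJ S hS)] at h
    have h0 : BV S (J S) = 0 := by linarith [hJskew S S, hVs (J S) S]
    simp [h0] at h
    rw [hVs S T]
    linarith
  have hαv0 : ∀ Z T, BL (α Z T) v = 0 := by
    obtain ⟨S, hS0⟩ := Module.finrank_pos_iff_exists_ne_zero.1
      (show 0 < Module.finrank ℝ (K X₀) by omega)
    let φ : K X₀ →ₗ[ℝ] ℝ × ℝ := ((BV S).prod (BV (J S))) ∘ₗ (K X₀).subtype
    have hφ := φ.finrank_range_add_finrank_ker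
    have hφ2 := Submodule.finrank_le (LinearMap.range φ)
    rw [Module.finrank_prod, Module.finrank_self] at hφ2
    obtain ⟨⟨S', hS'⟩, hS'0⟩ := Module.finrank_pos_iff_exists_ne_zero.1
      (show 0 < Module.finrank ℝ (LinearMap.ker φ) by omega)
    have e1 : BV S S' = 0 := congrArg Prod.fst (show φ S' = 0 from hS')
    have e2 : BV (J S) S' = 0 := congrArg Prod.snd (show φ S' = 0 from hS')
    have hp : 0 < BV (S : V) S := hVpos _ fun h => hS0 (Subtype.ext h)
    have hp' : 0 < BV (S' : V) S' := hVpos _ fun h => hS'0 (Subtype.ext (Subtype.ext h))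
    intro Z T
    have f1 := hαv S' S'.2 Z S
    have f2 := hαv S' S'.2 Z (J S)
    have f3 := hαv S S.2 Z T
    have e3 : BV (S : V) (J S') = 0 := by linarith [hJskew (S : V) S']
    rw [hVs S' S, e1, e3, zero_mul, zero_mul, add_zero, mul_eq_zero, or_iff_right hp'.ne'] at f1
    rw [hVs S' (J S), e2, hJiso, e1, zero_mul, zero_mul, add_zero, mul_eq_zero,
      or_iff_right hp'.ne'] at f2
    rw [f1, f2, mul_zero, mul_zero, add_zero, mul_eq_zero, or_iff_right hp.ne'] at f3
    rw [hLs, f3]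
  refine ⟨K X₀, m, hPJ, by omega, by omega, fun S hS => ⟨?_, fun b hb hbspan => ?_⟩⟩
  · have h1 := hβ1 S hS S
    simp only [hβ] at h1
    rw [eq_sub_of_add_eq' h1, map_sub, map_smul, hαv0, smul_zero]
    linarith [hpos _ (hαv0 S S), hpos _ (hαv0 S (J S))]
  · have htr := sum_eq_zero_of_anti_invariant hVsymm hJJ hJskew
      (α.compr₂ (BL.flip (α S S))) (fun X => ?_) hb hbspan
    · simp only [LinearMap.compr₂_apply, LinearMap.BilinForm.flip_apply] at htr
      rw [Finset.sum_sub_distrib, htr, zero_sub, neg_nonpos]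
      exact Finset.sum_nonneg fun i _ => hpos _ (hαv0 _ _)
    · have h := hcompat X X S S
      have hb0 : (β X X).2 = 0 := by simp [hβ, hαsymm (J X) X]
      rw [hBw, hBw, hb0, hγ, hγ, hspan0 _ (hker S hS X).1 _ (hαv0 _ _),
        hspan0 _ (hker S hS X).2 _ (hαv0 _ _)] at h
      simpa [hβ] using h
end

section
/- Let β : V^{2n} × V^{2n} → W^{p,p} be the flat bilinear form associated to α with ⟨α(X,Y),w⟩ = −(X,Y), w unit time-like, S(β) nondegenerate, s ≤ n, and the compatibility condition with γ. For p ≥ 4 assume additionally there is no nontrivial J-invariant subspace V₁ ⊆ V^{2n} with S(β|_{V₁×V₁}) degenerate and dim S(β|_{V₁×V₁}) ≤ dim V₁ − 2. Then s = n and there exists an orthogonal basis {X_i, JX_i}_{1≤i≤n} of V^{2n} such that β(Y_i,Y_j) = 0 for i ≠ j whenever Y_k ∈ span{X_k,JX_k}, and the vectors {β(X_j,X_j), β(X_j,JX_j)}_{1≤j≤n} form an orthonormal basis of S(β) with respect to ⟨⟨·,·⟩⟩. -/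
open Module

/-- If the rank of `f` is maximal along the pencil `f + t • g`, then `g` maps `ker f` into the
range of `f`. -/
lemma apply_mem_range_of_finrank_range_max {V W : Type*} [AddCommGroup V] [Module ℝ V]
    [AddCommGroup W] [Module ℝ W] [FiniteDimensional ℝ W] (f g : V →ₗ[ℝ] W)
    (hmax : ∀ t : ℝ, finrank ℝ (LinearMap.range (f + t • g)) ≤ finrank ℝ (LinearMap.range f))
    {y : V} (hy : f y = 0) : g y ∈ LinearMap.range f := by
  by_contra hgy
  let b := finBasis ℝ (LinearMap.range f)
  choose z hz using fun i => (b i).2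
  let v : ℝ → Option (Fin (finrank ℝ (LinearMap.range f))) → W :=
    fun t o => o.elim (g y) (fun i => f (z i) + t • g (z i))
  have hv0 : LinearIndependent ℝ (v 0) := by
    rw [linearIndependent_option]
    have hb : (v 0 ∘ some) = (LinearMap.range f).subtype ∘ b := by
      ext i
      simp [v, hz]
    rw [hb]
    refine ⟨b.linearIndependent.map' _ (Submodule.ker_subtype _), fun h => hgy ?_⟩
    refine Submodule.span_le.2 ?_ h
    rintro _ ⟨i, rfl⟩
    exact (b i).2
  let e : W ≃ₗ[ℝ] (Fin (finrank ℝ W) → ℝ) := (finBasis ℝ W).equivFun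
  have hev : ∀ᶠ t in nhdsWithin (0 : ℝ) {0}ᶜ, LinearIndependent ℝ (fun o => e (v t o)) := by
    have h0 : LinearIndependent ℝ (fun o => e (v 0 o)) :=
      hv0.map' e.toLinearMap (LinearEquiv.ker e)
    have hc : Continuous fun t => (fun o => e (v t o)) := by
      rw [continuous_pi_iff]
      intro o
      cases o with
      | none =>
        change Continuous fun _ : ℝ => e (g y)
        exact continuous_const
      | some i =>
        simp only [v, Option.elim_some, map_add, map_smul]
        fun_prop
    exact ((hc.tendsto 0).eventually
      (LinearIndependent.eventually (f := fun o => e (v 0 o)) h0)).filter_mono nhdsWithin_le_nhds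
  obtain ⟨t, ht, ht0⟩ := (hev.and self_mem_nhdsWithin).exists
  have hvt : LinearIndependent ℝ (v t) := LinearIndependent.of_comp e.toLinearMap ht
  have hle : Submodule.span ℝ (Set.range (v t)) ≤ LinearMap.range (f + t • g) := by
    refine Submodule.span_le.2 ?_
    rintro _ ⟨_ | i, rfl⟩
    · refine ⟨t⁻¹ • y, ?_⟩
      have : t ≠ 0 := ht0
      simp [v, hy, this]
    · exact ⟨z i, by simp [v]⟩
  have h1 := Submodule.finrank_mono hle
  rw [finrank_span_eq_card hvt, Fintype.card_option, Fintype.card_fin] at h1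
  have h2 := hmax t
  omega

/-- The radical of a subspace `R` of a nondegenerate subspace `S` has dimension at most the
codimension of `R` in `S`. -/
lemma finrank_inf_orthogonal_add_finrank_le {W : Type*} [AddCommGroup W] [Module ℝ W]
    [FiniteDimensional ℝ W] (B : LinearMap.BilinForm ℝ W) (hB : B.IsSymm) {R S : Submodule ℝ W}
    (hRS : R ≤ S) (hS : S ⊓ B.orthogonal S = ⊥) :
    finrank ℝ ↥(R ⊓ B.orthogonal R) + finrank ℝ R ≤ finrank ℝ S := by
  have h := LinearMap.BilinForm.finrank_add_finrank_orthogonal' (B := B.restrict S)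
    (R.comap S.subtype)
  have hker : LinearMap.ker (B.restrict S) = ⊥ := by
    refine LinearMap.ker_eq_bot'.2 fun x hx => ?_
    have hx' : (x : W) ∈ S ⊓ B.orthogonal S := by
      refine ⟨x.2, fun y hy => ?_⟩
      have := LinearMap.congr_fun hx ⟨y, hy⟩
      exact (hB.eq y x).trans this
    rw [hS] at hx'
    exact Subtype.ext hx'
  rw [hker, inf_bot_eq, finrank_bot, add_zero,
    (Submodule.comapSubtypeEquivOfLe hRS).finrank_eq] at h
  rw [← (Submodule.comapSubtypeEquivOfLe
    (inf_le_left.trans hRS : R ⊓ B.orthogonal R ≤ S)).finrank_eq]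
  have hle : (R ⊓ B.orthogonal R).comap S.subtype ≤
      (B.restrict S).orthogonal (R.comap S.subtype) := fun x hx y hy => hx.2 y hy
  have := Submodule.finrank_mono hle
  omega

/-- A commuting family of operators, symmetric for a positive definite bilinear form, has a basis
of common eigenvectors. -/
lemma exists_basis_common_eigenvectors {E ι : Type*} [AddCommGroup E] [Module ℝ E]
    [FiniteDimensional ℝ E] (B : LinearMap.BilinForm ℝ E) (hB : B.IsSymm)
    (hpos : ∀ x, x ≠ 0 → 0 < B x x) (T : ι → E →ₗ[ℝ] E)
    (hT : ∀ i x y, B (T i x) y = B x (T i y)) (hC : ∀ i j, Commute (T i) (T j)) :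
    ∃ (b : Basis (Fin (finrank ℝ E)) ℝ E) (c : Fin (finrank ℝ E) → ι → ℝ),
      ∀ k i, T i (b k) = c k i • b k := by
  classical
  let core : InnerProductSpace.Core ℝ E :=
    { inner := fun x y => B x y
      conj_inner_symm := fun x y => hB.eq y x
      re_inner_nonneg := fun x => by
        by_cases hx : x = 0
        · simp [hx]
        · exact (hpos x hx).le
      add_left := fun x y z => by simp
      smul_left := fun x y r => by simp
      definite := fun x hx => by
        by_contra h
        exact (hpos x h).ne' hx }
  let : NormedAddCommGroup E := core.toNormedAddCommGroup
  let : InnerProductSpace ℝ E := InnerProductSpace.ofCore core.toCore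
  have hint := LinearMap.IsSymmetric.directSum_isInternal_of_pairwise_commute
    (T := T) (fun i x y => hT i x y) (fun i j _ => hC i j)
  let b := hint.collectedBasis fun χ => finBasis ℝ _
  have : Finite (Σ χ : ι → ℝ, Fin (finrank ℝ
      ↥(⨅ j, Module.End.eigenspace (T j) (χ j)))) := Module.Finite.finite_basis b
  let := Fintype.ofFinite (Σ χ : ι → ℝ, Fin (finrank ℝ
      ↥(⨅ j, Module.End.eigenspace (T j) (χ j))))
  let σ := Fintype.equivFinOfCardEq (finrank_eq_card_basis b).symm
  refine ⟨b.reindex σ, fun k => (σ.symm k).1, fun k i => ?_⟩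
  rw [Basis.reindex_apply]
  have hmem := hint.collectedBasis_mem (fun χ => finBasis ℝ _) (σ.symm k)
  exact Module.End.mem_eigenspace_iff.1 ((Submodule.mem_iInf _).1 hmem i)

/-- A symmetric bilinear map `φ` whose fourfold products `⟨φ a b, φ c d⟩` are totally symmetric
and which pairs with some vector to a definite form can be diagonalized, provided some `φ x` is
injective with nondegenerate range containing all values of `φ`. -/
lemma exists_basis_diagonalizing {E L : Type*} [AddCommGroup E] [Module ℝ E]
    [FiniteDimensional ℝ E] [AddCommGroup L] [Module ℝ L]
    (BL : LinearMap.BilinForm ℝ L) (hBL : BL.IsSymm) (w : L)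
    (φ : E →ₗ[ℝ] E →ₗ[ℝ] L) (hφ : ∀ a b, φ a b = φ b a)
    (hflat : ∀ a b c d, BL (φ a b) (φ c d) = BL (φ a d) (φ c b))
    (hpos : ∀ a, a ≠ 0 → BL (φ a a) w < 0) (x : E) (hx : Function.Injective (φ x))
    (hrange : ∀ a b, φ a b ∈ LinearMap.range (φ x))
    (hnd : ∀ u ∈ LinearMap.range (φ x), (∀ a, BL u (φ x a) = 0) → u = 0) :
    ∃ b : Basis (Fin (finrank ℝ E)) ℝ E, (∀ i j, i ≠ j → φ (b i) (b j) = 0) ∧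
      (∀ i, BL (φ (b i) (b i)) (φ (b i) (b i)) = 1 ∨ BL (φ (b i) (b i)) (φ (b i) (b i)) = -1) ∧
      ∀ a c, φ a c ∈ Submodule.span ℝ (Set.range fun i => φ (b i) (b i)) := by
  let e := LinearEquiv.ofInjective (φ x) hx
  let D : E → E →ₗ[ℝ] E := fun z =>
    e.symm.toLinearMap ∘ₗ (φ z).codRestrict (LinearMap.range (φ x)) (hrange z)
  have hD : ∀ z a, φ x (D z a) = φ z a := fun z a =>
    congrArg Subtype.val (e.apply_symm_apply (⟨φ z a, hrange z a⟩ : LinearMap.range (φ x)))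
  have hext : ∀ a b c d, (∀ y, BL (φ a b) (φ x y) = BL (φ c d) (φ x y)) → φ a b = φ c d := by
    intro a b c d h
    refine sub_eq_zero.1 (hnd _ (sub_mem (hrange a b) (hrange c d)) fun y => ?_)
    simp [h y]
  have hself : ∀ z a b, φ (D z a) b = φ a (D z b) := by
    intro z a b
    refine hext _ _ _ _ fun y => ?_
    rw [hφ (D z a) b, hflat, hD, hflat a, hD, hflat, hφ b a, hflat]
  have hcomm : ∀ z z', Commute (D z) (D z') := by
    intro z z'
    refine LinearMap.ext fun a => hx ?_
    change φ x (D z (D z' a)) = φ x (D z' (D z a))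
    rw [hD, hD]
    refine hext _ _ _ _ fun y => ?_
    rw [hflat, hD, hflat z', hD, hBL.eq]
    exact hflat _ _ _ _
  obtain ⟨b, c, hbc⟩ := exists_basis_common_eigenvectors (-(φ.compr₂ (BL.flip w)))
    ⟨fun a b => by simp [hφ a b]⟩ (fun a ha => by simpa using hpos a ha) D
    (fun z a b => by simp [hself]) hcomm
  have hdiag : ∀ i j, i ≠ j → φ (b i) (b j) = 0 := by
    intro i j hij
    have h1 : φ x (c j (b i) • b j) = φ x (c i (b j) • b i) := by
      rw [← hbc, ← hbc, hD, hD, hφ]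
    have h2 : c j (b i) = 0 := by
      have := congrArg (fun v => b.repr v j) (hx h1)
      simpa [hij] using this
    rw [← hD, hbc, h2, zero_smul, map_zero]
  have hne : ∀ i, BL (φ (b i) (b i)) (φ (b i) (b i)) ≠ 0 := by
    intro i hi
    have hzero : φ.compr₂ (BL (φ (b i) (b i))) = 0 := by
      refine LinearMap.ext_basis b b fun j k => ?_
      by_cases hjk : j = k
      · subst hjk
        by_cases hij : i = j
        · subst hij
          simpa using hi
        · rw [LinearMap.compr₂_apply, hflat, hdiag i j hij]
          simp
      · simp [hdiag j k hjk]
    have h0 : φ (b i) (b i) = 0 :=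
      hnd _ (hrange _ _) fun a => LinearMap.congr_fun₂ hzero x a
    simpa [h0] using hpos (b i) (b.ne_zero i)
  let r : Fin (finrank ℝ E) → ℝ := fun i =>
    (√(√|BL (φ (b i) (b i)) (φ (b i) (b i))|))⁻¹
  have hr : ∀ i, r i ^ 4 * |BL (φ (b i) (b i)) (φ (b i) (b i))| = 1 := by
    intro i
    have h := abs_pos.2 (hne i)
    have h4 : √(√|BL (φ (b i) (b i)) (φ (b i) (b i))|) ^ 4 =
        |BL (φ (b i) (b i)) (φ (b i) (b i))| := by
      rw [show 4 = 2 * 2 from rfl, pow_mul, Real.sq_sqrt (Real.sqrt_nonneg _),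
        Real.sq_sqrt (abs_nonneg _)]
    simp only [r, inv_pow, h4]
    exact inv_mul_cancel₀ h.ne'
  have hr0 : ∀ i, r i ≠ 0 := fun i h => by simpa [h] using hr i
  have hdiag' : ∀ i j, i ≠ j → φ (r i • b i) (r j • b j) = 0 := fun i j hij => by
    simp [hdiag i j hij]
  refine ⟨b.isUnitSMul fun i => (hr0 i).isUnit, ?_, ?_, ?_⟩
  · simpa only [Basis.isUnitSMul_apply] using hdiag'
  · intro i
    have h : BL (φ (r i • b i) (r i • b i)) (φ (r i • b i) (r i • b i)) =
        r i ^ 4 * BL (φ (b i) (b i)) (φ (b i) (b i)) := by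
      simp only [map_smul, LinearMap.smul_apply, smul_eq_mul]
      ring
    rw [Basis.isUnitSMul_apply, h]
    have := hr i
    rcases abs_choice (BL (φ (b i) (b i)) (φ (b i) (b i))) with h | h <;> rw [h] at this
    · exact Or.inl this
    · exact Or.inr (by linarith)
  · set b' := b.isUnitSMul fun i => (hr0 i).isUnit with hb'
    set Q := Submodule.span ℝ (Set.range fun i => φ (b' i) (b' i)) with hQ
    have hzero : φ.compr₂ Q.mkQ = 0 := by
      refine LinearMap.ext_basis b' b' fun j k => ?_
      simp only [LinearMap.compr₂_apply, LinearMap.zero_apply, Submodule.mkQ_apply,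
        Submodule.Quotient.mk_eq_zero]
      by_cases hjk : j = k
      · subst hjk
        exact Submodule.subset_span ⟨j, rfl⟩
      · rw [hb', Basis.isUnitSMul_apply, Basis.isUnitSMul_apply, hdiag' j k hjk]
        exact zero_mem _
    exact fun a c => (Submodule.Quotient.mk_eq_zero Q).1 (LinearMap.congr_fun₂ hzero a c)

/-- The product of two submodules has the sum of their dimensions as its dimension. -/
lemma finrank_submodule_prod {L : Type*} [AddCommGroup L] [Module ℝ L] [FiniteDimensional ℝ L]
    (p q : Submodule ℝ L) : finrank ℝ ↥(p.prod q) = finrank ℝ p + finrank ℝ q := by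
  let e : (p.prod q) ≃ₗ[ℝ] p × q :=
    { toFun := fun z => (⟨z.1.1, z.2.1⟩, ⟨z.1.2, z.2.2⟩)
      invFun := fun z => ⟨(z.1, z.2), z.1.2, z.2.2⟩
      map_add' := fun _ _ => rfl
      map_smul' := fun _ _ => rfl
      left_inv := fun _ => rfl
      right_inv := fun _ => rfl }
  rw [e.finrank_eq, finrank_prod]

/-- In a Lorentzian space a null vector orthogonal to a null vector that is not orthogonal to the
time-like direction `w` is a multiple of it. -/
lemma mem_span_singleton_of_null {L : Type*} [AddCommGroup L] [Module ℝ L]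
    (BL : LinearMap.BilinForm ℝ L) (hBL : BL.IsSymm) {w : L}
    (hLor : ∀ x : L, BL x w = 0 → x ≠ 0 → 0 < BL x x) {a b : L} (haw : BL a w ≠ 0)
    (haa : BL a a = 0) (hbb : BL b b = 0) (hba : BL b a = 0) : b ∈ Submodule.span ℝ {a} := by
  refine Submodule.mem_span_singleton.2 ⟨BL b w / BL a w, ?_⟩
  by_contra h
  have hab : BL a b = 0 := (hBL.eq b a).symm.trans hba
  refine (hLor (b - (BL b w / BL a w) • a) ?_ (sub_ne_zero.2 (Ne.symm h))).ne' ?_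
  · simp [haw]
  · simp [haa, hbb, hba, hab]

section Hermitian

variable {V L : Type*} [AddCommGroup V] [Module ℝ V] [AddCommGroup L] [Module ℝ L]
  {BL : LinearMap.BilinForm ℝ L} {w : L} {J : V →ₗ[ℝ] V} {β : V →ₗ[ℝ] V →ₗ[ℝ] L × L}
  {Bw : LinearMap.BilinForm ℝ (L × L)}

/-- A flat sesquihermitian form `β` with time-like diagonal values and nondegenerate span has an
injective partial map `β X`, unless it has a large subspace with degenerate image. -/
lemma exists_ker_eq_bot [FiniteDimensional ℝ V] [FiniteDimensional ℝ L] (hBL : BL.IsSymm)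
    (hLor : ∀ x : L, BL x w = 0 → x ≠ 0 → 0 < BL x x)
    (hBw : ∀ a b : L × L, Bw a b = BL a.1 b.1 - BL a.2 b.2)
    (hβJ : ∀ X Y, β X (J Y) = ((β X Y).2, -(β X Y).1))
    (hβswap : ∀ X Y, β Y X = ((β X Y).1, -(β X Y).2))
    (hflat : ∀ X Y Z T : V, Bw (β X Y) (β Z T) = Bw (β X T) (β Z Y))
    (hpos : ∀ X, X ≠ 0 → BL (β X X).1 w < 0)
    {S : Submodule ℝ (L × L)} (hS : S = Submodule.span ℝ {z : L × L | ∃ X Y : V, z = β X Y})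
    (hnondeg : S ⊓ Bw.orthogonal S = ⊥) (hdim : finrank ℝ S ≤ finrank ℝ V)
    (hlarge : finrank ℝ S ≤ 6 ∨ ¬ ∃ V₁ : Submodule ℝ V, V₁ ≠ ⊥ ∧ (∀ x ∈ V₁, J x ∈ V₁) ∧
      (Submodule.span ℝ {z : L × L | ∃ X ∈ V₁, ∃ Y ∈ V₁, z = β X Y} ⊓
        Bw.orthogonal (Submodule.span ℝ {z : L × L | ∃ X ∈ V₁, ∃ Y ∈ V₁, z = β X Y}) ≠ ⊥) ∧
      finrank ℝ (Submodule.span ℝ {z : L × L | ∃ X ∈ V₁, ∃ Y ∈ V₁, z = β X Y}) + 2 ≤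
        finrank ℝ V₁) :
    ∃ X, LinearMap.ker (β X) = ⊥ := by
  have hBws : Bw.IsSymm := ⟨fun a b => by simp [hBw, hBL.eq a.1, hBL.eq a.2]⟩
  obtain ⟨X, hX⟩ : ∃ X, ∀ Y, finrank ℝ (LinearMap.range (β Y)) ≤
      finrank ℝ (LinearMap.range (β X)) := by
    have hbdd : BddAbove (Set.range fun X => finrank ℝ (LinearMap.range (β X))) :=
      ⟨finrank ℝ (L × L), by rintro _ ⟨Y, rfl⟩; exact Submodule.finrank_le _⟩
    obtain ⟨X, hX⟩ := Nat.sSup_mem (Set.range_nonempty _) hbdd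
    exact ⟨X, fun Y => (le_csSup hbdd ⟨Y, rfl⟩).trans_eq hX.symm⟩
  refine ⟨X, ?_⟩
  by_contra hker
  obtain ⟨y, hy, hy0⟩ := Submodule.exists_mem_ne_zero_of_ne_bot hker
  rw [LinearMap.mem_ker] at hy
  set R := LinearMap.range (β X) with hR
  set I := R ⊓ Bw.orthogonal R with hI
  have hβI : ∀ Z Y, β X Y = 0 → β Z Y ∈ I := by
    refine fun Z Y hY => ⟨?_, ?_⟩
    · refine apply_mem_range_of_finrank_range_max (β X) (β Z) (fun t => ?_) hY
      rw [← map_smul, ← map_add]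
      exact hX _
    · rintro _ ⟨T, rfl⟩
      exact (hflat X T Z Y).trans (by simp [hY])
  have hIrot : ∀ u ∈ I, ((u.2, -u.1) : L × L) ∈ I := by
    rintro _ ⟨⟨Y, rfl⟩, hu⟩
    refine ⟨⟨J Y, hβJ X Y⟩, ?_⟩
    rintro _ ⟨T, rfl⟩
    have := hu _ ⟨J T, rfl⟩
    simp only [hβJ, hBw, map_neg, LinearMap.neg_apply] at this ⊢
    linarith
  have hII : ∀ a ∈ I, ∀ b ∈ I, Bw a b = 0 := fun a ha b hb => hb.2 a ha.1
  have hII' : ∀ a ∈ I, ∀ b ∈ I, BL a.1 b.2 + BL a.2 b.1 = 0 := fun a ha b hb => by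
    have := hII a ha _ (hIrot b hb)
    simp only [hBw, map_neg] at this
    linarith
  have hdiag : ∀ Y, (β Y Y).2 = 0 := fun Y => by
    have := congrArg Prod.snd (hβswap Y Y)
    have h2 : (2 : ℝ) • (β Y Y).2 = 0 := (two_smul ℝ _).trans (eq_neg_iff_add_eq_zero.1 this)
    exact (smul_eq_zero.1 h2).resolve_left two_ne_zero
  set v := (β y y).1 with hv
  have hvy : β y y = (v, 0) := Prod.ext rfl (hdiag y)
  have hvI : ((v, 0) : L × L) ∈ I := hvy ▸ hβI y y hy
  have hvw : BL v w ≠ 0 := (hpos y hy0).ne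
  have hv0 : v ≠ 0 := fun h => hvw (by simp [h])
  have hvv : BL v v = 0 := by simpa [hBw] using hII _ hvI _ hvI
  set P := (Submodule.span ℝ {v}).prod (Submodule.span ℝ {v}) with hP
  have hPdim : finrank ℝ P = 2 := by
    rw [hP, finrank_submodule_prod, finrank_span_singleton hv0]
  have hvspan : v ∈ Submodule.span ℝ {v} := Submodule.mem_span_singleton_self v
  have hPI : P ≤ I := by
    rintro ⟨a, b⟩ ⟨ha, hb⟩
    obtain ⟨s, rfl⟩ := Submodule.mem_span_singleton.1 ha
    obtain ⟨t, rfl⟩ := Submodule.mem_span_singleton.1 hb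
    convert I.sub_mem (I.smul_mem s hvI) (I.smul_mem t (hIrot _ hvI)) using 1
    simp
  have hconj : ∀ a : L × L, a ∈ I → (a.1, -a.2) ∈ I → a ∈ P := by
    intro a ha ha'
    have h1 := hII _ ha _ ha
    have h2 := hII _ ha _ ha'
    have h3 := hII _ ha _ hvI
    have h4 := hII' _ ha _ hvI
    simp only [hBw, map_neg, map_zero, sub_zero, zero_add] at h1 h2 h3 h4
    exact ⟨mem_span_singleton_of_null BL hBL hLor hvw hvv (by linarith) h3,
      mem_span_singleton_of_null BL hBL hLor hvw hvv (by linarith) h4⟩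
  have hIdim : finrank ℝ I ≤ 3 := by
    have hRS : R ≤ S := by
      rintro _ ⟨T, rfl⟩
      exact hS ▸ Submodule.subset_span ⟨X, T, rfl⟩
    have h1 : finrank ℝ I + finrank ℝ R ≤ finrank ℝ S :=
      finrank_inf_orthogonal_add_finrank_le Bw hBws hRS hnondeg
    have h2 : finrank ℝ I ≤ finrank ℝ R := Submodule.finrank_mono inf_le_left
    rcases hlarge with h | h
    · omega
    · by_contra hI4
      have h3 : finrank ℝ R + _ = _ := LinearMap.finrank_range_add_finrank_ker (β X)
      have hle : Submodule.span ℝ {z : L × L | ∃ Y ∈ LinearMap.ker (β X),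
          ∃ Z ∈ LinearMap.ker (β X), z = β Y Z} ≤ P := by
        refine Submodule.span_le.2 ?_
        rintro _ ⟨Y, hY, Z, hZ, rfl⟩
        exact hconj _ (hβI Y Z hZ) (hβswap Y Z ▸ hβI Z Y hY)
      refine h ⟨LinearMap.ker (β X), hker, fun x hx => ?_, fun hbot => ?_, ?_⟩
      · rw [LinearMap.mem_ker] at hx ⊢
        simp [hβJ, hx]
      · have : β y y = 0 := by
          rw [← Submodule.mem_bot ℝ, ← hbot]
          refine ⟨Submodule.subset_span ⟨y, hy, y, hy, rfl⟩, fun a ha => ?_⟩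
          exact hII _ (hPI (hle ha)) _ (hβI y y hy)
        exact hv0 (by rw [hv, this, Prod.fst_zero])
      · have := Submodule.finrank_mono hle
        omega
  have hIP : I ≤ P := by
    intro u hu
    by_contra huP
    have hlt : P < P ⊔ Submodule.span ℝ {u} := by
      refine lt_of_le_of_ne le_sup_left fun h => huP ?_
      rw [h]
      exact Submodule.mem_sup_right (Submodule.mem_span_singleton_self u)
    have h1 := Submodule.finrank_lt_finrank_of_lt hlt
    have h2 : P ⊔ Submodule.span ℝ {u} = I := Submodule.eq_of_le_of_finrank_le
      (sup_le hPI ((Submodule.span_singleton_le_iff_mem _ _).2 hu)) (by omega)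
    have h3 := hIrot u hu
    rw [← h2] at h3
    obtain ⟨q, hq, r, hr, hqr⟩ := Submodule.mem_sup.1 h3
    obtain ⟨c, rfl⟩ := Submodule.mem_span_singleton.1 hr
    have e1 : q.1 + c • u.1 = u.2 := congrArg Prod.fst hqr
    have e2 : q.2 + c • u.2 = -u.1 := congrArg Prod.snd hqr
    have hc : (1 + c ^ 2) ≠ 0 := by positivity
    have hu1 : u.1 = (1 + c ^ 2)⁻¹ • (-q.2 - c • q.1) := by
      rw [eq_inv_smul_iff₀ hc]
      linear_combination (norm := module) e2 + c • e1
    have hu1' : u.1 ∈ Submodule.span ℝ {v} := by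
      rw [hu1]
      exact Submodule.smul_mem _ _ (sub_mem (neg_mem hq.2) (Submodule.smul_mem _ _ hq.1))
    exact huP ⟨hu1', e1 ▸ add_mem hq.1 (Submodule.smul_mem _ _ hu1')⟩
  have hvS : ((v, 0) : L × L) ∈ S ⊓ Bw.orthogonal S := by
    refine ⟨hS ▸ Submodule.subset_span ⟨y, y, hvy.symm⟩, fun a ha => ?_⟩
    have hle : S ≤ LinearMap.ker (Bw.flip (v, 0)) := by
      rw [hS]
      refine Submodule.span_le.2 ?_
      rintro _ ⟨Z, T, rfl⟩
      change Bw (β Z T) (v, 0) = 0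
      rw [← hvy, hflat]
      obtain ⟨h1, h2⟩ := hIP (hβI Z y hy)
      obtain ⟨h3, h4⟩ := hIP (hβI T y hy)
      exact hII _ (hPI ⟨h1, h2⟩) _ (hPI (hβswap T y ▸ ⟨h3, neg_mem h4⟩))
    exact hle ha
  rw [hnondeg, Submodule.mem_bot] at hvS
  exact hv0 (congrArg Prod.fst hvS)

/-- A flat sesquihermitian form `β` with time-like diagonal values, one injective partial map
`β X` and nondegenerate span of full dimension is diagonalizable. -/
lemma exists_diagonalizing_of_ker_eq_bot [FiniteDimensional ℝ V] (hBL : BL.IsSymm)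
    (hBw : ∀ a b : L × L, Bw a b = BL a.1 b.1 - BL a.2 b.2)
    (hβJ : ∀ X Y, β X (J Y) = ((β X Y).2, -(β X Y).1))
    (hβswap : ∀ X Y, β Y X = ((β X Y).1, -(β X Y).2))
    (hflat : ∀ X Y Z T : V, Bw (β X Y) (β Z T) = Bw (β X T) (β Z Y))
    (hpos : ∀ X, X ≠ 0 → BL (β X X).1 w < 0)
    {S : Submodule ℝ (L × L)} (hβS : ∀ X Y, β X Y ∈ S) (hnondeg : S ⊓ Bw.orthogonal S = ⊥)
    {X : V} (hX : LinearMap.ker (β X) = ⊥) (hrange : LinearMap.range (β X) = S) {n : ℕ}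
    (hn : finrank ℝ (S.map (LinearMap.fst ℝ L L)) = n) :
    ∃ e : Fin n → V, (∀ i j, i ≠ j → β (e i) (e j) = 0) ∧
      Submodule.span ℝ (Set.range (Sum.elim e fun i => J (e i))) = ⊤ ∧
      Submodule.span ℝ (Set.range (Sum.elim (fun i => β (e i) (e i)) fun i => β (e i) (J (e i))))
        = S ∧
      ∀ i, BL (β (e i) (e i)).1 (β (e i) (e i)).1 = 1 ∨
        BL (β (e i) (e i)).1 (β (e i) (e i)).1 = -1 := by
  have hinj : Function.Injective (β X) := LinearMap.ker_eq_bot.1 hX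
  have hdiag : ∀ Y, (β Y Y).2 = 0 := fun Y => by
    have h2 : (2 : ℝ) • (β Y Y).2 = 0 :=
      (two_smul ℝ _).trans (eq_neg_iff_add_eq_zero.1 (congrArg Prod.snd (hβswap Y Y)))
    exact (smul_eq_zero.1 h2).resolve_left two_ne_zero
  let E : Submodule ℝ V := LinearMap.ker (LinearMap.snd ℝ L L ∘ₗ β X)
  have hE : ∀ a ∈ E, β X a = ((β X a).1, 0) := fun a ha => Prod.ext rfl ha
  have hE' : ∀ a ∈ E, β a X = ((β X a).1, 0) := fun a ha => by
    rw [hβswap X a, show (β X a).2 = 0 from ha, neg_zero]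
  have hrot : ∀ s ∈ S, ((s.2, -s.1) : L × L) ∈ S := by
    rw [← hrange]
    rintro _ ⟨T, rfl⟩
    exact ⟨J T, hβJ X T⟩
  have hfst : ∀ s ∈ S, ∃ d ∈ E, β X d = (s.1, 0) := by
    intro s hs
    have hmem : ((s.1, 0) : L × L) ∈ S := by
      rw [← hrange] at hs
      obtain ⟨T, rfl⟩ := hs
      have := S.smul_mem (2⁻¹ : ℝ) (S.add_mem (hβS X T) (hβS T X))
      rw [hβswap X T] at this
      convert this using 1
      ext
      · simp [← two_smul ℝ]
      · simp
    rw [← hrange] at hmem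
    obtain ⟨d, hd⟩ := hmem
    exact ⟨d, congrArg Prod.snd hd, hd⟩
  have hreal : ∀ a ∈ E, ∀ b ∈ E, (β a b).2 = 0 := by
    intro a ha b hb
    have horth : ∀ d ∈ E, BL (β a b).2 (β X d).1 = 0 := by
      intro d hd
      have e1 := hflat a b d (J X)
      have e2 := hflat X (J a) d b
      have e3 := hflat b X d (J a)
      simp only [hBw, hβJ, hE' a ha, hE' b hb, hE' d hd, show (β X a).2 = 0 from ha,
        show (β X b).2 = 0 from hb, hβswap a b, map_zero,
        map_neg, LinearMap.zero_apply, LinearMap.neg_apply] at e1 e2 e3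
      linarith
    have hmem : ((0, (β a b).2) : L × L) ∈ S ⊓ Bw.orthogonal S := by
      refine ⟨?_, fun s hs => ?_⟩
      · obtain ⟨d, -, hd⟩ := hfst _ (hrot _ (hβS a b))
        have := hrot _ (hβS X d)
        rw [hd] at this
        convert S.neg_mem this using 1
        simp
      · obtain ⟨d, hd, hds⟩ := hfst _ (hrot _ hs)
        have h := horth d hd
        rw [hds] at h
        simpa [hBw] using (hBL.eq _ _).trans h
    rw [hnondeg] at hmem
    exact congrArg Prod.snd hmem
  let φ : E →ₗ[ℝ] E →ₗ[ℝ] L := (β.domRestrict₁₂ E E).compr₂ (LinearMap.fst ℝ L L)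
  have hφ : ∀ a b : E, β a b = (φ a b, 0) := fun a b => Prod.ext rfl (hreal a a.2 b b.2)
  let x : E := ⟨X, hdiag X⟩
  have hφx : Function.Injective (φ x) := fun a b hab =>
    Subtype.ext (hinj ((hφ x a).trans ((congrArg (·, (0 : L)) hab).trans (hφ x b).symm)))
  have hφrange : ∀ a b, φ a b ∈ LinearMap.range (φ x) := fun a b => by
    obtain ⟨d, hd, hds⟩ := hfst _ (hβS a b)
    exact ⟨⟨d, hd⟩, (congrArg Prod.fst hds :)⟩
  obtain ⟨b, hb, hb1, hbspan⟩ := exists_basis_diagonalizing BL hBL w φ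
    (fun a b => by simpa [hφ] using congrArg Prod.fst (hβswap b a))
    (fun a b c d => by simpa [hφ, hBw] using hflat a b c d)
    (fun a ha => hpos a (by simpa using ha)) x hφx hφrange (by
      rintro _ ⟨a, rfl⟩ h
      have hmem : β X a ∈ S ⊓ Bw.orthogonal S := by
        refine ⟨hβS X a, fun s hs => ?_⟩
        obtain ⟨d, hd, hds⟩ := hfst s hs
        have := h ⟨d, hd⟩
        rw [hE a a.2, hBw, map_zero, sub_zero, hBL.eq]
        rw [show s.1 = (β X d).1 by rw [hds]]
        exact this
      rw [hnondeg] at hmem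
      exact congrArg Prod.fst hmem)
  have hEn : finrank ℝ E = n := by
    have hmap : LinearMap.range (φ x) = S.map (LinearMap.fst ℝ L L) := by
      refine le_antisymm ?_ ?_
      · rintro _ ⟨a, rfl⟩
        exact ⟨_, hβS X a, rfl⟩
      rintro _ ⟨s, hs, rfl⟩
      obtain ⟨d, hd, hds⟩ := hfst s hs
      exact ⟨⟨d, hd⟩, (congrArg Prod.fst hds :)⟩
    rw [← hn, ← hmap, LinearMap.finrank_range_of_inj hφx]
  subst hEn
  refine ⟨fun i => b i, fun i j hij => ?_, ?_, ?_, fun i => hb1 i⟩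
  · rw [hφ, hb i j hij, Prod.mk_zero_zero]
  · set Q := Submodule.span ℝ (Set.range (Sum.elim (fun i => (b i : V)) fun i => J (b i)))
    have hEQ : E ≤ Q ⊓ Q.comap J := by
      intro d hd
      have : (⟨d, hd⟩ : E) ∈ (Q ⊓ Q.comap J).comap E.subtype := by
        refine Submodule.span_le.2 ?_ (b.mem_span ⟨d, hd⟩)
        rintro _ ⟨i, rfl⟩
        exact ⟨Submodule.subset_span ⟨Sum.inl i, rfl⟩, Submodule.subset_span ⟨Sum.inr i, rfl⟩⟩
      exact this
    refine eq_top_iff.2 fun T _ => ?_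
    obtain ⟨d, hd, hdT⟩ := hfst _ (hβS X T)
    obtain ⟨d', hd', hdT'⟩ := hfst _ (hrot _ (hβS X T))
    have hT : T = d - J d' := by
      refine hinj ?_
      rw [map_sub, hβJ, hdT, hdT']
      simp
    rw [hT]
    exact sub_mem (hEQ hd).1 (hEQ hd').2
  · set Q := Submodule.span ℝ (Set.range
      (Sum.elim (fun i => β (b i : V) (b i)) fun i => β (b i : V) (J (b i))))
    refine le_antisymm (Submodule.span_le.2 ?_) fun s hs => ?_
    · rintro _ ⟨i | i, rfl⟩
      · exact hβS _ _
      · exact hβS _ _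
    · have hle : Submodule.span ℝ (Set.range fun i => φ (b i) (b i)) ≤
          Q.comap (LinearMap.inl ℝ L L) ⊓ Q.comap (LinearMap.inr ℝ L L) := by
        refine Submodule.span_le.2 ?_
        rintro _ ⟨i, rfl⟩
        refine ⟨Submodule.subset_span ⟨Sum.inl i, hφ _ _⟩, ?_⟩
        change ((0, φ (b i) (b i)) : L × L) ∈ Q
        rw [← Submodule.neg_mem_iff]
        refine Submodule.subset_span ⟨Sum.inr i, ?_⟩
        simp [hβJ, hφ]
      obtain ⟨d, hd, hds⟩ := hfst s hs
      obtain ⟨d', hd', hds'⟩ := hfst _ (hrot s hs)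
      have h1 := (hle (hbspan x ⟨d, hd⟩)).1
      have h2 := (hle (hbspan x ⟨d', hd'⟩)).2
      have e1 : φ x ⟨d, hd⟩ = s.1 := (congrArg Prod.fst hds :)
      have e2 : φ x ⟨d', hd'⟩ = s.2 := (congrArg Prod.fst hds' :)
      rw [e1] at h1
      rw [e2] at h2
      convert Q.add_mem h1 h2 using 1
      simp

/-- The span of the values of a sesquihermitian form is the complexification of its real part. -/
lemma span_values_eq_prod (hβJ : ∀ X Y, β X (J Y) = ((β X Y).2, -(β X Y).1))
    (hβswap : ∀ X Y, β Y X = ((β X Y).1, -(β X Y).2)) {S : Submodule ℝ (L × L)}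
    (hS : S = Submodule.span ℝ {z : L × L | ∃ X Y : V, z = β X Y}) :
    S = (S.map (LinearMap.fst ℝ L L)).prod (S.map (LinearMap.fst ℝ L L)) := by
  have hβS : ∀ X Y, β X Y ∈ S := fun X Y => hS ▸ Submodule.subset_span ⟨X, Y, rfl⟩
  have hrot : ∀ s ∈ S, ((s.2, -s.1) : L × L) ∈ S := by
    have hle : S ≤ S.comap ((LinearMap.snd ℝ L L).prod (-LinearMap.fst ℝ L L)) := by
      conv_lhs => rw [hS]
      refine Submodule.span_le.2 ?_
      rintro _ ⟨X, Y, rfl⟩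
      have h := hβS X (J Y)
      rw [hβJ] at h
      exact h
    exact fun s hs => hle hs
  have hconj : ∀ s ∈ S, ((s.1, -s.2) : L × L) ∈ S := by
    have hle : S ≤ S.comap ((LinearMap.fst ℝ L L).prod (-LinearMap.snd ℝ L L)) := by
      conv_lhs => rw [hS]
      refine Submodule.span_le.2 ?_
      rintro _ ⟨X, Y, rfl⟩
      have h := hβS Y X
      rw [hβswap X Y] at h
      exact h
    exact fun s hs => hle hs
  have hfst : ∀ s ∈ S, ((s.1, 0) : L × L) ∈ S := by
    intro s hs
    convert S.smul_mem (2⁻¹ : ℝ) (S.add_mem hs (hconj s hs)) using 1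
    ext
    · simp [← two_smul ℝ]
    · simp
  refine le_antisymm (fun s hs => ⟨⟨s, hs, rfl⟩, ⟨_, hrot s hs, rfl⟩⟩) ?_
  rintro ⟨_, _⟩ ⟨⟨s, hs, rfl⟩, ⟨t, ht, rfl⟩⟩
  convert S.sub_mem (hfst s hs) (hrot _ (hfst t ht)) using 1
  simp

end Hermitian

/-- Proposition (diagonalization): β flat, S(β) nondegenerate, s ≤ n, compatibility
with γ, and (for p ≥ 4) no nontrivial J-invariant V₁ with S(β|_{V₁×V₁}) degenerate of
dim ≤ dim V₁ − 2. Then s = n and there is an orthogonal basis {X_i, JX_i} of V with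
β(Y_i,Y_j) = 0 for i ≠ j and {β(X_j,X_j), β(X_j,JX_j)} an orthonormal basis of S(β). -/
theorem stmt_17 (n p : ℕ) (V L : Type*) [AddCommGroup V] [Module ℝ V] [FiniteDimensional ℝ V]
    [AddCommGroup L] [Module ℝ L] [FiniteDimensional ℝ L]
    (hdV : Module.finrank ℝ V = 2 * n) (hdL : Module.finrank ℝ L = p)
    (BV : LinearMap.BilinForm ℝ V) (hVsymm : BV.IsSymm)
    (hVpos : ∀ X : V, X ≠ 0 → 0 < BV X X)
    (J : V →ₗ[ℝ] V) (hJ : J ∘ₗ J = -LinearMap.id)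
    (hJiso : ∀ X Y : V, BV (J X) (J Y) = BV X Y)
    (BL : LinearMap.BilinForm ℝ L) (hLsymm : BL.IsSymm)
    (w : L) (hw : BL w w = -1)
    (hLor : ∀ x : L, BL x w = 0 → x ≠ 0 → 0 < BL x x)
    (α : V →ₗ[ℝ] V →ₗ[ℝ] L) (hαsymm : ∀ X Y : V, α X Y = α Y X)
    (hαw : ∀ X Y : V, BL (α X Y) w = -(BV X Y))
    (β : V →ₗ[ℝ] V →ₗ[ℝ] L × L)
    (hβ : ∀ X Y : V, β X Y = (α X Y + α (J X) (J Y), α X (J Y) - α (J X) Y))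
    (Bw : LinearMap.BilinForm ℝ (L × L))
    (hBw : ∀ a b : L × L, Bw a b = BL a.1 b.1 - BL a.2 b.2)
    (hflat : ∀ X Y Z T : V, Bw (β X Y) (β Z T) = Bw (β X T) (β Z Y))
    (γ : V → V → L × L) (hγ : ∀ X Y : V, γ X Y = (α X Y, α X (J Y)))
    (hcompat : ∀ X Y Z T : V, Bw (β X Y) (γ Z T) = Bw (β X T) (γ Z Y))
    (Sβ : Submodule ℝ (L × L))
    (hSβ : Sβ = Submodule.span ℝ {z : L × L | ∃ X Y : V, z = β X Y})
    (hnondeg : Sβ ⊓ Bw.orthogonal Sβ = ⊥)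
    (hsn : Module.finrank ℝ (Submodule.map (LinearMap.fst ℝ L L) Sβ) ≤ n)
    (hp4 : 4 ≤ p → ¬ ∃ V₁ : Submodule ℝ V, V₁ ≠ ⊥ ∧ (∀ x ∈ V₁, J x ∈ V₁) ∧
      (Submodule.span ℝ {z : L × L | ∃ X ∈ V₁, ∃ Y ∈ V₁, z = β X Y} ⊓
        Bw.orthogonal (Submodule.span ℝ {z : L × L | ∃ X ∈ V₁, ∃ Y ∈ V₁, z = β X Y}) ≠ ⊥) ∧
      Module.finrank ℝ
          (Submodule.span ℝ {z : L × L | ∃ X ∈ V₁, ∃ Y ∈ V₁, z = β X Y}) + 2 ≤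
        Module.finrank ℝ V₁) :
    Module.finrank ℝ (Submodule.map (LinearMap.fst ℝ L L) Sβ) = n ∧
    ∃ (X : Fin n → V) (F : Fin n ⊕ Fin n → V) (G : Fin n ⊕ Fin n → L × L),
      F = Sum.elim X (fun i => J (X i)) ∧
      G = Sum.elim (fun j => β (X j) (X j)) (fun j => β (X j) (J (X j))) ∧
      (∀ a, F a ≠ 0) ∧
      (∀ a b, a ≠ b → BV (F a) (F b) = 0) ∧
      Submodule.span ℝ (Set.range F) = ⊤ ∧
      (∀ i j : Fin n, i ≠ j → ∀ Yi ∈ Submodule.span ℝ {X i, J (X i)},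
        ∀ Yj ∈ Submodule.span ℝ {X j, J (X j)}, β Yi Yj = 0) ∧
      Submodule.span ℝ (Set.range G) = Sβ ∧
      (∀ a b, a ≠ b → Bw (G a) (G b) = 0) ∧
      (∀ a, Bw (G a) (G a) = 1 ∨ Bw (G a) (G a) = -1) := by
  have hJJ : ∀ Y, J (J Y) = -Y := fun Y => LinearMap.congr_fun hJ Y
  have hβJ : ∀ X Y, β X (J Y) = ((β X Y).2, -(β X Y).1) := fun X Y => by
    simp only [hβ, hJJ, map_neg, Prod.mk.injEq]
    constructor <;> abel
  have hβswap : ∀ X Y, β Y X = ((β X Y).1, -(β X Y).2) := fun X Y => by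
    simp only [hβ, hαsymm Y, hαsymm (J Y), neg_sub]
  have hβw : ∀ X Y, BL (β X Y).1 w = -2 * BV X Y := fun X Y => by
    simp only [hβ, map_add, LinearMap.add_apply, hαw, hJiso]
    ring
  have hpos : ∀ X, X ≠ 0 → BL (β X X).1 w < 0 := fun X hX => by
    have := hVpos X hX
    rw [hβw]
    linarith
  have hβS : ∀ X Y, β X Y ∈ Sβ := fun X Y => hSβ ▸ Submodule.subset_span ⟨X, Y, rfl⟩
  have hdim : Module.finrank ℝ Sβ = 2 * Module.finrank ℝ (Sβ.map (LinearMap.fst ℝ L L)) := by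
    conv_lhs => rw [span_values_eq_prod hβJ hβswap hSβ]
    rw [finrank_submodule_prod, two_mul]
  obtain ⟨X, hX⟩ := exists_ker_eq_bot hLsymm hLor hBw hβJ hβswap hflat hpos hSβ hnondeg
    (by omega) (by
      by_cases hp : 4 ≤ p
      · exact Or.inr (hp4 hp)
      · have := Submodule.finrank_le (Sβ.map (LinearMap.fst ℝ L L))
        exact Or.inl (by omega))
  have hle : LinearMap.range (β X) ≤ Sβ := by
    rintro _ ⟨T, rfl⟩
    exact hβS X T
  have hrank : Module.finrank ℝ (LinearMap.range (β X)) = 2 * n := by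
    rw [LinearMap.finrank_range_of_inj (LinearMap.ker_eq_bot.1 hX), hdV]
  have hn : Module.finrank ℝ (Sβ.map (LinearMap.fst ℝ L L)) = n := by
    have := Submodule.finrank_mono hle
    omega
  obtain ⟨e, he, hspan, hspanβ, hnorm⟩ := exists_diagonalizing_of_ker_eq_bot hLsymm hBw hβJ hβswap
    hflat hpos hβS hnondeg hX (Submodule.eq_of_le_of_finrank_le hle (by omega)) hn
  have hJβ : ∀ X Y, β (J X) Y = -β X (J Y) := fun X Y => by
    rw [hβswap Y (J X), hβJ, hβJ, hβswap X Y]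
    simp
  have hβe : ∀ i j, i ≠ j → ∀ Y ∈ Submodule.span ℝ {e i, J (e i)},
      ∀ Z ∈ Submodule.span ℝ {e j, J (e j)}, β Y Z = 0 := by
    intro i j hij Y hY Z hZ
    obtain ⟨a, b, rfl⟩ := Submodule.mem_span_pair.1 hY
    obtain ⟨c, d, rfl⟩ := Submodule.mem_span_pair.1 hZ
    simp [hJβ, hβJ, hJJ, he i j hij]
  have hβ0 : ∀ Y Z, β Y Z = 0 → BV Y Z = 0 := fun Y Z h => by
    have := hβw Y Z
    rw [h, Prod.fst_zero, map_zero, LinearMap.zero_apply] at this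
    linarith
  have hBVJ : ∀ Y, BV Y (J Y) = 0 := fun Y => by
    have h := hJiso Y (J Y)
    rw [hJJ, map_neg] at h
    have h2 : BV (J Y) Y = BV Y (J Y) := hVsymm.eq _ _
    linarith
  have hdiag : ∀ Y, (β Y Y).2 = 0 := fun Y => by
    have h2 : (2 : ℝ) • (β Y Y).2 = 0 :=
      (two_smul ℝ _).trans (eq_neg_iff_add_eq_zero.1 (congrArg Prod.snd (hβswap Y Y)))
    exact (smul_eq_zero.1 h2).resolve_left two_ne_zero
  have he0 : ∀ i, e i ≠ 0 := fun i h => by simpa [h] using hnorm i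
  have hmem : ∀ i, e i ∈ Submodule.span ℝ {e i, J (e i)} := fun i =>
    Submodule.subset_span (Set.mem_insert _ _)
  have hJmem : ∀ i, J (e i) ∈ Submodule.span ℝ {e i, J (e i)} := fun i =>
    Submodule.subset_span (Set.mem_insert_of_mem _ rfl)
  have horth : ∀ i j, i ≠ j → BL (β (e i) (e i)).1 (β (e j) (e j)).1 = 0 := fun i j hij => by
    simpa [hBw, hdiag, he i j hij] using hflat (e i) (e i) (e j) (e j)
  refine ⟨hn, e, _, _, rfl, rfl, ?_, ?_, hspan, hβe, hspanβ, ?_, ?_⟩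
  · rintro (i | i)
    · exact he0 i
    · exact fun h => he0 i (by simpa [show J (e i) = 0 from h] using hJJ (e i))
  · rintro (i | i) (j | j) hij
    · have hij : i ≠ j := fun h => hij (h ▸ rfl)
      exact hβ0 _ _ (hβe i j hij _ (hmem i) _ (hmem j))
    · obtain rfl | hij := eq_or_ne i j
      · exact hBVJ _
      · exact hβ0 _ _ (hβe i j hij _ (hmem i) _ (hJmem j))
    · obtain rfl | hij := eq_or_ne i j
      · exact (hVsymm.eq _ _).trans (hBVJ _)
      · exact hβ0 _ _ (hβe i j hij _ (hJmem i) _ (hmem j))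
    · have hij : i ≠ j := fun h => hij (h ▸ rfl)
      exact hβ0 _ _ (hβe i j hij _ (hJmem i) _ (hJmem j))
  · rintro (i | i) (j | j) hij
    · simp [hBw, hdiag, horth i j fun h => hij (h ▸ rfl)]
    · simp [hBw, hdiag, hβJ]
    · simp [hBw, hdiag, hβJ]
    · simp [hBw, hdiag, hβJ, horth i j fun h => hij (h ▸ rfl)]
  · rintro (i | i)
    · simpa [hBw, hdiag] using hnorm i
    · simpa [hBw, hdiag, hβJ, neg_eq_iff_eq_neg, or_comm] using hnorm i
end
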